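/- arXiv:2008.00935 — 2 statements merged into one kernel-verified Lean document; each statement's English description precedes it below -/
import Mathlib

section
/- Let 𝒫₁ and 𝒫₂ be generalized 2-dimensional polytopes in ℝ², let I be a nonempty open interval in ℝ with 0 ∉ I, and let σ(t) = (t, t²) (a parameterization of the parabola). If F_{𝒫₁}(σ(t)) = F_{𝒫₂}(σ(t)) for every t ∈ I, then 𝒫₁ = 𝒫₂. -/
open scoped RealInnerProductSpace

/-- The Fourier transform of (the characteristic function of) a set `P ⊆ ℝⁿ`. -/
noncomputable def fourierTransformSet {n : ℕ} (P : Set (EuclideanSpace ℝ (Fin n)))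
    (s : EuclideanSpace ℝ (Fin n)) : ℂ :=
  ∫ x in P, Complex.exp (-Complex.I * ((⟪s, x⟫ : ℝ) : ℂ))

/-- A convex `n`-dimensional polytope in `ℝⁿ`. -/
def IsConvexPolytope {n : ℕ} (P : Set (EuclideanSpace ℝ (Fin n))) : Prop :=
  ∃ V : Finset (EuclideanSpace ℝ (Fin n)),
    P = convexHull ℝ (V : Set (EuclideanSpace ℝ (Fin n))) ∧ (interior P).Nonempty

/-- A generalized `n`-dimensional polytope in `ℝⁿ`. -/
def IsGenPolytope {n : ℕ} (P : Set (EuclideanSpace ℝ (Fin n))) : Prop :=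
  ∃ (m : ℕ) (Q : Fin (m + 1) → Set (EuclideanSpace ℝ (Fin n))),
    (∀ i, IsConvexPolytope (Q i)) ∧ P = ⋃ i, Q i

open MeasureTheory Set


noncomputable def ek (s1 s2 x y : ℝ) : ℂ := Complex.exp (-Complex.I * ((s1 * x + s2 * y : ℝ) : ℂ))

def ExpRat (G : ℝ → ℝ → ℂ) : Prop :=
  ∃ (ι : Type) (_ : Fintype ι) (c : ι → ℂ) (p x y : ι → ℝ), ∀ s1 s2 : ℝ, s2 ≠ 0 →
    (∀ j, s1 + p j * s2 ≠ 0) →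
    G s1 s2 = ∑ j, c j / (s2 * (s1 + p j * s2)) * ek s1 s2 (x j) (y j)

lemma ExpRat.zero : ExpRat (fun _ _ => 0) :=
  ⟨Empty, inferInstance, fun _ => 0, fun _ => 0, fun _ => 0, fun _ => 0, by simp⟩

lemma ExpRat.add {G H : ℝ → ℝ → ℂ} (hG : ExpRat G) (hH : ExpRat H) :
    ExpRat (fun a b => G a b + H a b) := by
  obtain ⟨ι, _, c, p, x, y, h⟩ := hG
  obtain ⟨κ, _, c', p', x', y', h'⟩ := hH
  refine ⟨ι ⊕ κ, inferInstance, Sum.elim c c', Sum.elim p p', Sum.elim x x', Sum.elim y y', ?_⟩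
  intro s1 s2 hs hj
  rw [Fintype.sum_sum_type]
  simp only [Sum.elim_inl, Sum.elim_inr]
  rw [h s1 s2 hs (fun j => by simpa using hj (Sum.inl j)),
    h' s1 s2 hs (fun j => by simpa using hj (Sum.inr j))]

lemma ExpRat.smul {G : ℝ → ℝ → ℂ} (r : ℂ) (hG : ExpRat G) :
    ExpRat (fun a b => r * G a b) := by
  obtain ⟨ι, _, c, p, x, y, h⟩ := hG
  refine ⟨ι, inferInstance, fun j => r * c j, p, x, y, ?_⟩
  intro s1 s2 hs hj
  simp only
  rw [h s1 s2 hs hj, Finset.mul_sum]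
  exact Finset.sum_congr rfl fun j _ => by ring

lemma ExpRat.sum {ι : Type*} (S : Finset ι) (G : ι → ℝ → ℝ → ℂ) (hG : ∀ i ∈ S, ExpRat (G i)) :
    ExpRat (fun a b => ∑ i ∈ S, G i a b) := by
  classical
  induction S using Finset.induction_on with
  | empty => simpa using ExpRat.zero
  | insert i S hi ih =>
    simp only [Finset.sum_insert hi]
    exact (hG i (by simp)).add (ih fun j hj => hG j (by simp [hj]))

lemma ek_cont (s1 s2 : ℝ) : Continuous (fun z : ℝ × ℝ => ek s1 s2 z.1 z.2) := by
  unfold ek; fun_prop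

lemma ek_intOn (s1 s2 M : ℝ) {T : Set (ℝ × ℝ)} (hT : T ⊆ Icc (-M, -M) (M, M)) :
    IntegrableOn (fun z : ℝ × ℝ => ek s1 s2 z.1 z.2) T :=
  ((ek_cont s1 s2).integrableOn_Icc).mono_set hT

/-- integral over one-dim interval -/
lemma int_ordConnected {J : Set ℝ} (hJ : J.OrdConnected) {M : ℝ} (hM : J ⊆ Icc (-M) M) :
    ∃ c d : ℝ, ∀ f : ℝ → ℂ, ∫ x in J, f x = ∫ x in c..d, f x := by
  rcases J.eq_empty_or_nonempty with rfl | hne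
  · exact ⟨0, 0, by simp⟩
  · have hb : BddBelow J := bddBelow_Icc.mono hM
    have ha : BddAbove J := bddAbove_Icc.mono hM
    have hc : IsConnected J := ⟨hne, hJ.isPreconnected⟩
    have h1 := hc.Ioo_csInf_csSup_subset hb ha
    have h2 := subset_Icc_csInf_csSup hb ha
    refine ⟨sInf J, sSup J, fun f => ?_⟩
    rw [intervalIntegral.integral_of_le (csInf_le_csSup hne hb ha)]
    apply setIntegral_congr_set
    have e1 : (Ioo (sInf J) (sSup J) : Set ℝ) =ᵐ[volume] Icc (sInf J) (sSup J) := Ioo_ae_eq_Icc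
    have : J =ᵐ[volume] Icc (sInf J) (sSup J) :=
      h2.eventuallyLE.antisymm (e1.symm.le.trans h1.eventuallyLE)
    exact this.trans Ioc_ae_eq_Icc.symm

lemma int_ek_y (s1 s2 x u v : ℝ) (hs : s2 ≠ 0) (huv : u ≤ v) :
    ∫ y in Icc u v, ek s1 s2 x y = (ek s1 s2 x v - ek s1 s2 x u) / (-Complex.I * s2) := by
  rw [integral_Icc_eq_integral_Ioc, ← intervalIntegral.integral_of_le huv]
  have h : ∀ y : ℝ, ek s1 s2 x y = Complex.exp (-Complex.I * (s1 * x)) *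
      Complex.exp ((-Complex.I * s2) * y) := by
    intro y; rw [← Complex.exp_add]; unfold ek; push_cast; ring_nf
  simp_rw [h]
  rw [intervalIntegral.integral_const_mul, integral_exp_mul_complex (by simpa using hs)]
  ring

lemma int_ek_line (s1 s2 p q c d : ℝ) (hs : s1 + p * s2 ≠ 0) :
    ∫ x in c..d, ek s1 s2 x (p * x + q) =
      (ek s1 s2 d (p * d + q) - ek s1 s2 c (p * c + q)) / (-Complex.I * (s1 + p * s2)) := by
  have h : ∀ x : ℝ, ek s1 s2 x (p * x + q) = Complex.exp (-Complex.I * (s2 * q)) *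
      Complex.exp ((-Complex.I * (s1 + p * s2)) * x) := by
    intro y; rw [← Complex.exp_add]; unfold ek; push_cast; ring_nf
  simp_rw [h]
  rw [intervalIntegral.integral_const_mul, integral_exp_mul_complex]
  · ring
  · have : ((s1 + p * s2 : ℝ) : ℂ) ≠ 0 := by exact_mod_cast hs
    push_cast at this
    simpa using this

def trap (J : Set ℝ) (p q p' q' : ℝ) : Set (ℝ × ℝ) :=
  {z | z.1 ∈ J ∧ p * z.1 + q ≤ z.2 ∧ z.2 ≤ p' * z.1 + q'}

lemma trap_meas {J : Set ℝ} (hJ : J.OrdConnected) (p q p' q' : ℝ) :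
    MeasurableSet (trap J p q p' q') := by
  unfold trap
  refine (hJ.measurableSet.preimage measurable_fst).inter (MeasurableSet.inter ?_ ?_)
  · exact measurableSet_le (f := fun z : ℝ × ℝ => p * z.1 + q) (g := fun z : ℝ × ℝ => z.2)
      (by fun_prop) (by fun_prop)
  · exact measurableSet_le (f := fun z : ℝ × ℝ => z.2) (g := fun z : ℝ × ℝ => p' * z.1 + q')
      (by fun_prop) (by fun_prop)

lemma trap_box {J : Set ℝ} {M p q p' q' : ℝ} (hM : J ⊆ Icc (-M) M)
    (hlo : ∀ x ∈ J, -M ≤ p * x + q) (hup : ∀ x ∈ J, p' * x + q' ≤ M) :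
    trap J p q p' q' ⊆ Icc (-M, -M) (M, M) := by
  rintro ⟨x, y⟩ ⟨hx, h1, h2⟩
  exact ⟨⟨(hM hx).1, (hlo x hx).trans h1⟩, ⟨(hM hx).2, h2.trans (hup x hx)⟩⟩

lemma expRat_trap {J : Set ℝ} (hJ : J.OrdConnected) {M p q p' q' : ℝ} (hM : J ⊆ Icc (-M) M)
    (hlo : ∀ x ∈ J, -M ≤ p * x + q) (hup : ∀ x ∈ J, p' * x + q' ≤ M)
    (hle : ∀ x ∈ J, p * x + q ≤ p' * x + q') :
    ExpRat (fun s1 s2 => ∫ z in trap J p q p' q', ek s1 s2 z.1 z.2) := by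
  obtain ⟨c, d, hcd⟩ := int_ordConnected hJ hM
  refine ⟨Fin 4, inferInstance, ![-1, 1, 1, -1], ![p', p', p, p], ![d, c, d, c],
    ![p' * d + q', p' * c + q', p * d + q, p * c + q], ?_⟩
  intro s1 s2 hs hj
  have hp' : s1 + p' * s2 ≠ 0 := hj 0
  have hp : s1 + p * s2 ≠ 0 := hj 2
  have hint := ek_intOn s1 s2 M (trap_box hM hlo hup)
  have hm := trap_meas hJ p q p' q'
  have key : ∫ z in trap J p q p' q', ek s1 s2 z.1 z.2 =
      ∫ x in J, (ek s1 s2 x (p' * x + q') - ek s1 s2 x (p * x + q)) / (-Complex.I * s2) := by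
    rw [← integral_indicator hm, Measure.volume_eq_prod, integral_prod _ (by
      rw [← Measure.volume_eq_prod]; exact hint.integrable_indicator hm),
      ← integral_indicator hJ.measurableSet]
    congr 1
    ext x
    by_cases hx : x ∈ J
    · rw [indicator_of_mem hx, ← int_ek_y s1 s2 x _ _ hs (hle x hx),
        ← integral_indicator measurableSet_Icc]
      congr 1
      ext y
      simp [indicator, trap, hx]
    · rw [indicator_of_notMem hx]
      simp [indicator, trap, hx]
  simp only
  rw [key, hcd, intervalIntegral.integral_div, intervalIntegral.integral_sub,
    int_ek_line _ _ _ _ _ _ hp', int_ek_line _ _ _ _ _ _ hp]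
  · simp [Fin.sum_univ_succ]
    have hs' : (s2 : ℂ) ≠ 0 := by exact_mod_cast hs
    have h1 : ((s1 + p * s2 : ℝ) : ℂ) ≠ 0 := by exact_mod_cast hp
    have h2 : ((s1 + p' * s2 : ℝ) : ℂ) ≠ 0 := by exact_mod_cast hp'
    push_cast at h1 h2
    have hI := Complex.I_sq
    field_simp
    rw [hI]
    ring
  · apply Continuous.intervalIntegrable; unfold ek; fun_prop
  · apply Continuous.intervalIntegrable; unfold ek; fun_prop

lemma ordConn_nonneg (a c : ℝ) : ({x : ℝ | 0 ≤ a * x + c}).OrdConnected := by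
  refine ⟨fun x hx y hy z hz => ?_⟩
  simp only [mem_ofPred_eq, mem_Icc] at *
  rcases le_total 0 a with h | h <;> nlinarith

lemma ordConn_pos (a c : ℝ) : ({x : ℝ | 0 < a * x + c}).OrdConnected := by
  refine ⟨fun x hx y hy z hz => ?_⟩
  simp only [mem_ofPred_eq, mem_Icc] at *
  rcases le_total 0 a with h | h <;> nlinarith

def HP (K : List (ℝ × ℝ × ℝ)) : Set (ℝ × ℝ) :=
  {z | ∀ k ∈ K, 0 ≤ k.1 * z.1 + k.2.1 * z.2 + k.2.2}

lemma HP_meas (K : List (ℝ × ℝ × ℝ)) : MeasurableSet (HP K) := by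
  have : HP K = ⋂ k ∈ {k | k ∈ K}, {z : ℝ × ℝ | 0 ≤ k.1 * z.1 + k.2.1 * z.2 + k.2.2} := by
    ext z; simp [HP]
  rw [this]
  refine MeasurableSet.biInter (List.finite_toSet K).countable fun k _ => ?_
  exact measurableSet_le (by fun_prop) (by fun_prop)

lemma expRat_split {A B C : Set (ℝ × ℝ)} {M : ℝ} (h : A = B ∪ C) (hd : Disjoint B C)
    (hC : MeasurableSet C) (hA : A ⊆ Icc (-M, -M) (M, M))
    (eB : ExpRat (fun s1 s2 => ∫ z in B, ek s1 s2 z.1 z.2))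
    (eC : ExpRat (fun s1 s2 => ∫ z in C, ek s1 s2 z.1 z.2)) :
    ExpRat (fun s1 s2 => ∫ z in A, ek s1 s2 z.1 z.2) := by
  subst h
  convert eB.add eC using 3 with s1 s2
  exact setIntegral_union hd hC (ek_intOn _ _ M (subset_union_left.trans hA))
    (ek_intOn _ _ M (subset_union_right.trans hA))

lemma expRat_HP (M : ℝ) (K : List (ℝ × ℝ × ℝ)) : ∀ (J : Set ℝ) (p q p' q' : ℝ), J.OrdConnected →
    J ⊆ Icc (-M) M → (∀ x ∈ J, -M ≤ p * x + q) → (∀ x ∈ J, p' * x + q' ≤ M) →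
    ExpRat (fun s1 s2 => ∫ z in trap J p q p' q' ∩ HP K, ek s1 s2 z.1 z.2) := by
  induction K with
  | nil =>
    intro J p q p' q' hJ hM hlo hup
    have h : trap J p q p' q' ∩ HP [] =
        trap (J ∩ {x | 0 ≤ (p' - p) * x + (q' - q)}) p q p' q' := by
      ext ⟨x, y⟩
      simp only [trap, HP, mem_inter_iff, mem_ofPred_eq, List.not_mem_nil, false_imp_iff,
        implies_true, and_true]
      constructor
      · rintro ⟨h1, h2, h3⟩
        exact ⟨⟨h1, by linarith⟩, h2, h3⟩
      · rintro ⟨⟨h1, _⟩, h2, h3⟩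
        exact ⟨h1, h2, h3⟩
    rw [h]
    refine expRat_trap (M := M) (hJ.inter (ordConn_nonneg _ _)) (inter_subset_left.trans hM)
      (fun x hx => hlo x hx.1) (fun x hx => hup x hx.1) (fun x hx => ?_)
    have := hx.2
    simp only [mem_ofPred_eq] at this
    linarith
  | cons k K ih =>
    intro J p q p' q' hJ hM hlo hup
    obtain ⟨a, b, c⟩ := k
    have hbox : trap J p q p' q' ∩ HP ((a, b, c) :: K) ⊆ Icc (-M, -M) (M, M) :=
      inter_subset_left.trans (trap_box hM hlo hup)
    have hcons : ∀ x y : ℝ, (x, y) ∈ HP ((a, b, c) :: K) ↔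
        0 ≤ a * x + b * y + c ∧ (x, y) ∈ HP K := by
      intro x y; simp [HP]
    rcases lt_trichotomy b 0 with hb | hb | hb
    · have hk : ∀ x y : ℝ, 0 ≤ a * x + b * y + c ↔ y ≤ (-a / b) * x + (-c / b) := by
        intro x y
        have : (-a / b) * x + (-c / b) = (-(a * x + c)) / b := by ring
        rw [this, le_div_iff_of_neg hb]
        constructor <;> intro h <;> linarith
      refine expRat_split (M := M)
        (B := trap (J ∩ {x | 0 ≤ ((-a / b) - p') * x + ((-c / b) - q')}) p q p' q' ∩ HP K)
        (C := trap (J ∩ {x | 0 < (p' - (-a / b)) * x + (q' - (-c / b))}) p q (-a / b) (-c / b)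
          ∩ HP K) ?_ ?_ ?_ hbox ?_ ?_
      · ext ⟨x, y⟩
        simp only [mem_union, mem_inter_iff, hcons, trap, mem_ofPred_eq, hk]
        constructor
        · rintro ⟨⟨h1, h2, h3⟩, h4, h5⟩
          rcases le_or_gt (p' * x + q') ((-a / b) * x + (-c / b)) with h | h
          · left; exact ⟨⟨⟨h1, by linarith⟩, h2, h3⟩, h5⟩
          · right; exact ⟨⟨⟨h1, by linarith⟩, h2, h4⟩, h5⟩
        · rintro (⟨⟨⟨h1, h⟩, h2, h3⟩, h5⟩ | ⟨⟨⟨h1, h⟩, h2, h3⟩, h5⟩)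
          · exact ⟨⟨h1, h2, h3⟩, by linarith, h5⟩
          · exact ⟨⟨h1, h2, by linarith⟩, h3, h5⟩
      · rw [Set.disjoint_left]
        rintro ⟨x, y⟩ ⟨⟨⟨_, h⟩, _⟩, _⟩ ⟨⟨⟨_, h'⟩, _⟩, _⟩
        simp only [mem_ofPred_eq] at h h'
        linarith
      · exact (trap_meas (hJ.inter (ordConn_pos _ _)) _ _ _ _).inter (HP_meas K)
      · exact ih _ _ _ _ _ (hJ.inter (ordConn_nonneg _ _)) (inter_subset_left.trans hM)
          (fun x hx => hlo x hx.1) (fun x hx => hup x hx.1)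
      · refine ih _ _ _ _ _ (hJ.inter (ordConn_pos _ _)) (inter_subset_left.trans hM)
          (fun x hx => hlo x hx.1) (fun x hx => ?_)
        have h1 := hup x hx.1
        have h2 := hx.2
        simp only [mem_ofPred_eq] at h2
        linarith
    · have h : trap J p q p' q' ∩ HP ((a, b, c) :: K) =
          trap (J ∩ {x | 0 ≤ a * x + c}) p q p' q' ∩ HP K := by
        ext ⟨x, y⟩
        rw [mem_inter_iff, hcons]
        simp only [mem_inter_iff, trap, mem_ofPred_eq, hb, zero_mul, add_zero]
        tauto
      rw [h]
      exact ih _ _ _ _ _ (hJ.inter (ordConn_nonneg _ _)) (inter_subset_left.trans hM)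
          (fun x hx => hlo x hx.1) (fun x hx => hup x hx.1)
    · have hk : ∀ x y : ℝ, 0 ≤ a * x + b * y + c ↔ (-a / b) * x + (-c / b) ≤ y := by
        intro x y
        have : (-a / b) * x + (-c / b) = (-(a * x + c)) / b := by ring
        rw [this, div_le_iff₀ hb]
        constructor <;> intro h <;> linarith
      refine expRat_split (M := M)
        (B := trap (J ∩ {x | 0 ≤ (p - (-a / b)) * x + (q - (-c / b))}) p q p' q' ∩ HP K)
        (C := trap (J ∩ {x | 0 < ((-a / b) - p) * x + ((-c / b) - q)}) (-a / b) (-c / b) p' q'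
          ∩ HP K) ?_ ?_ ?_ hbox ?_ ?_
      · ext ⟨x, y⟩
        simp only [mem_union, mem_inter_iff, hcons, trap, mem_ofPred_eq, hk]
        constructor
        · rintro ⟨⟨h1, h2, h3⟩, h4, h5⟩
          rcases le_or_gt ((-a / b) * x + (-c / b)) (p * x + q) with h | h
          · left; exact ⟨⟨⟨h1, by linarith⟩, h2, h3⟩, h5⟩
          · right; exact ⟨⟨⟨h1, by linarith⟩, h4, h3⟩, h5⟩
        · rintro (⟨⟨⟨h1, h⟩, h2, h3⟩, h5⟩ | ⟨⟨⟨h1, h⟩, h2, h3⟩, h5⟩)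
          · exact ⟨⟨h1, h2, h3⟩, by linarith, h5⟩
          · exact ⟨⟨h1, by linarith, h3⟩, h2, h5⟩
      · rw [Set.disjoint_left]
        rintro ⟨x, y⟩ ⟨⟨⟨_, h⟩, _⟩, _⟩ ⟨⟨⟨_, h'⟩, _⟩, _⟩
        simp only [mem_ofPred_eq] at h h'
        linarith
      · exact (trap_meas (hJ.inter (ordConn_pos _ _)) _ _ _ _).inter (HP_meas K)
      · exact ih _ _ _ _ _ (hJ.inter (ordConn_nonneg _ _)) (inter_subset_left.trans hM)
          (fun x hx => hlo x hx.1) (fun x hx => hup x hx.1)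
      · refine ih _ _ _ _ _ (hJ.inter (ordConn_pos _ _)) (inter_subset_left.trans hM)
          (fun x hx => ?_) (fun x hx => hup x hx.1)
        have h1 := hlo x hx.1
        have h2 := hx.2
        simp only [mem_ofPred_eq] at h2
        linarith

lemma expRat_of_ae_HP {A : Set (ℝ × ℝ)} {M : ℝ} (hA : A ⊆ Icc (-M, -M) (M, M))
    (K : List (ℝ × ℝ × ℝ)) (h : A =ᵐ[volume] HP K) :
    ExpRat (fun s1 s2 => ∫ z in A, ek s1 s2 z.1 z.2) := by
  have hbox : trap (Icc (-M) M) 0 (-M) 0 M = Icc (-M, -M) (M, M) := by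
    ext ⟨x, y⟩
    simp only [trap, mem_Icc, mem_ofPred_eq, Prod.mk_le_mk]
    constructor
    · rintro ⟨⟨h1, h2⟩, h3, h4⟩; exact ⟨⟨h1, by linarith⟩, h2, by linarith⟩
    · rintro ⟨⟨h1, h2⟩, h3, h4⟩; exact ⟨⟨h1, h3⟩, by linarith, by linarith⟩
  have := expRat_HP M K (Icc (-M) M) 0 (-M) 0 M ordConnected_Icc le_rfl (by simp) (by simp)
  rw [hbox] at this
  convert this using 3 with s1 s2
  apply setIntegral_congr_set
  have h2 : (Icc (-M, -M) (M, M) ∩ A : Set (ℝ × ℝ)) =ᵐ[volume]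
    (Icc (-M, -M) (M, M) ∩ HP K : Set (ℝ × ℝ)) := (ae_eq_refl _).inter h
  rwa [inter_eq_self_of_subset_right hA] at h2
open Filter Topology Polynomial in
lemma term_tendsto (x y : ℝ) (h : y < 0 ∨ (y = 0 ∧ x < 0)) (Q : ℂ[X]) :
    Tendsto (fun r : ℝ => Q.eval ((r : ℂ) * (1 + Complex.I)) *
      Complex.exp (-Complex.I * (((r : ℂ) * (1 + Complex.I)) * x +
        ((r : ℂ) * (1 + Complex.I)) ^ 2 * y))) atTop (𝓝 0) := by
  induction Q using Polynomial.induction_on' with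
  | add p q hp hq => simpa [add_mul] using hp.add hq
  | monomial n c =>
    obtain ⟨δ, hδ, hE⟩ : ∃ δ : ℝ, 0 < δ ∧ ∀ᶠ r : ℝ in atTop, r * x + 2 * r ^ 2 * y ≤ -δ * r := by
      rcases h with h | ⟨h, h'⟩
      · refine ⟨1, one_pos, ?_⟩
        filter_upwards [eventually_ge_atTop 0, eventually_ge_atTop ((x + 1) / (-2 * y))] with r h0 hr
        rw [div_le_iff₀ (by linarith)] at hr
        nlinarith
      · exact ⟨-x, by linarith, Eventually.of_forall fun r => by subst h; linarith⟩
    have hnorm : ∀ r : ℝ, ‖Complex.exp (-Complex.I * (((r : ℂ) * (1 + Complex.I)) * x +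
        ((r : ℂ) * (1 + Complex.I)) ^ 2 * y))‖ = Real.exp (r * x + 2 * r ^ 2 * y) := by
      intro r
      rw [Complex.norm_exp]
      congr 1
      simp [pow_two]
      ring_nf
      simp
    rw [tendsto_zero_iff_norm_tendsto_zero]
    have hlim : Tendsto (fun r : ℝ => (‖c‖ * ‖(1 + Complex.I)‖ ^ n) * (r ^ n / Real.exp (δ * r)))
        atTop (𝓝 0) := by
      have := (isLittleO_pow_exp_pos_mul_atTop n hδ).tendsto_div_nhds_zero
      simpa using this.const_mul (‖c‖ * ‖(1 + Complex.I)‖ ^ n)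
    refine squeeze_zero' (Eventually.of_forall fun r => norm_nonneg _) ?_ hlim
    filter_upwards [hE, eventually_ge_atTop 0] with r hr h0
    rw [norm_mul, hnorm, eval_monomial, norm_mul, norm_pow, norm_mul, Complex.norm_real,
      Real.norm_of_nonneg h0, mul_pow, div_eq_mul_inv, ← Real.exp_neg]
    have : Real.exp (r * x + 2 * r ^ 2 * y) ≤ Real.exp (-(δ * r)) :=
      Real.exp_le_exp.2 (by linarith)
    calc _ ≤ ‖c‖ * (r ^ n * ‖(1 + Complex.I)‖ ^ n) * Real.exp (-(δ * r)) := by gcongr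
      _ = _ := by ring

open Filter Topology Polynomial in
lemma linind (W : Finset (ℝ × ℝ)) (Q : ℝ × ℝ → ℂ[X])
    (h : ∀ z : ℂ, ∑ v ∈ W, (Q v).eval z *
      Complex.exp (-Complex.I * (z * v.1 + z ^ 2 * v.2)) = 0) :
    ∀ v ∈ W, Q v = 0 := by
  classical
  induction W using Finset.induction_on_max_value (fun v : ℝ × ℝ => toLex (v.2, v.1)) with
  | empty => simp
  | insert a s ha hmax ih =>
    have hQ : Q a = 0 := by
      have hz : Tendsto (fun r : ℝ => (Q a).eval ((r : ℂ) * (1 + Complex.I))) atTop (𝓝 0) := by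
        have hs : Tendsto (fun r : ℝ => - ∑ v ∈ s, (Q v).eval ((r : ℂ) * (1 + Complex.I)) *
          Complex.exp (-Complex.I * (((r : ℂ) * (1 + Complex.I)) * ((v.1 - a.1 : ℝ) : ℂ) +
          ((r : ℂ) * (1 + Complex.I)) ^ 2 * ((v.2 - a.2 : ℝ) : ℂ)))) atTop (𝓝 0) := by
          have : (0 : ℂ) = - ∑ v ∈ s, 0 := by simp
          rw [this]
          refine (tendsto_finsetSum _ fun v hv => term_tendsto _ _ ?_ _).neg
          have hle := hmax v hv
          rw [Prod.Lex.toLex_le_toLex] at hle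
          rcases hle with hle | ⟨h1, h2⟩
          · left; simpa using hle
          · right
            simp only at h1 h2
            refine ⟨by linarith, ?_⟩
            rcases h2.lt_or_eq with h3 | h3
            · linarith
            · exact absurd (Prod.ext h3 h1 ▸ hv) ha
        refine hs.congr fun r => ?_
        have hr := h ((r : ℂ) * (1 + Complex.I))
        rw [Finset.sum_insert ha] at hr
        generalize (r : ℂ) * (1 + Complex.I) = z at *
        have key : ∀ v ∈ s, (Q v).eval z * Complex.exp (-Complex.I * (z * ((v.1 - a.1 : ℝ) : ℂ) +
          z ^ 2 * ((v.2 - a.2 : ℝ) : ℂ))) = (Q v).eval z *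
          Complex.exp (-Complex.I * (z * v.1 + z ^ 2 * v.2)) *
            (Complex.exp (-Complex.I * (z * a.1 + z ^ 2 * a.2)))⁻¹ := by
          intro v _
          rw [← Complex.exp_neg, mul_assoc, ← Complex.exp_add]
          push_cast
          ring_nf
        rw [Finset.sum_congr rfl key, ← Finset.sum_mul]
        have hne := Complex.exp_ne_zero (-Complex.I * (z * a.1 + z ^ 2 * a.2))
        rw [← eq_sub_iff_add_eq', zero_sub] at hr
        rw [hr]
        field_simp
      by_contra hne
      by_cases hd : 0 < (Q a).degree
      · have hzn : Tendsto (fun r : ℝ => ‖(r : ℂ) * (1 + Complex.I)‖) atTop atTop := by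
          simp only [norm_mul, Complex.norm_real]
          refine Tendsto.atTop_mul_const ?_ tendsto_norm_atTop_atTop
          rw [norm_pos_iff]
          intro h1
          simpa using congrArg Complex.re h1
        have h1 := (Q a).tendsto_norm_atTop hd hzn
        exact not_tendsto_nhds_of_tendsto_atTop h1 _ hz.norm
      · have hc := eq_C_of_degree_le_zero (not_lt.1 hd)
        rw [hc] at hz
        simp only [eval_C] at hz
        have := tendsto_nhds_unique hz tendsto_const_nhds
        rw [← this] at hc
        simp at hc
        exact hne hc
    have hrest : ∀ v ∈ s, Q v = 0 := by
      apply ih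
      intro z
      have := h z
      rw [Finset.sum_insert ha, hQ] at this
      simpa using this
    intro v hv
    rcases Finset.mem_insert.1 hv with rfl | hv
    · exact hQ
    · exact hrest v hv
open Filter Topology Polynomial in
lemma expRat_vanish {G : ℝ → ℝ → ℂ} (hG : ExpRat G) {a b : ℝ} (hab : a < b)
    (h : ∀ t ∈ Ioo a b, G t (t ^ 2) = 0) :
    ∃ (ι : Type) (_ : Fintype ι) (p : ι → ℝ), ∀ s1 s2 : ℝ, s1 ≠ 0 → s2 ≠ 0 →
      (∀ j, s1 + p j * s2 ≠ 0) → G s1 s2 = 0 := by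
  classical
  obtain ⟨ι, _, c, p, x, y, hG⟩ := hG
  refine ⟨ι, inferInstance, p, ?_⟩
  set D : ι → ℂ[X] := fun j => C (c j) * ∏ i ∈ Finset.univ.erase j, (1 + C (p i : ℂ) * X) with hD
  have hform : ∀ s1 s2 : ℝ, s1 ≠ 0 → s2 ≠ 0 → (∀ j, s1 + p j * s2 ≠ 0) →
      (∏ i, (1 + (p i : ℂ) * (s2 / s1 : ℂ)) ≠ 0) ∧
      G s1 s2 = ((s1 : ℂ) * s2 * ∏ i, (1 + (p i : ℂ) * (s2 / s1 : ℂ)))⁻¹ *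
        ∑ j, (D j).eval (s2 / s1 : ℂ) * ek s1 s2 (x j) (y j) := by
    intro s1 s2 h1 h2 hj
    have h1' : (s1 : ℂ) ≠ 0 := by exact_mod_cast h1
    have h2' : (s2 : ℂ) ≠ 0 := by exact_mod_cast h2
    have hj' : ∀ j, (s1 : ℂ) + p j * s2 ≠ 0 := fun j => by exact_mod_cast hj j
    have hf : ∀ j, (1 + (p j : ℂ) * (s2 / s1 : ℂ)) ≠ 0 := by
      intro j h0
      apply hj' j
      field_simp at h0
      linear_combination h0
    have hprod : (∏ i, (1 + (p i : ℂ) * (s2 / s1 : ℂ)) ≠ 0) :=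
      Finset.prod_ne_zero_iff.2 fun i _ => hf i
    refine ⟨hprod, ?_⟩
    rw [hG s1 s2 h2 hj, Finset.mul_sum]
    refine Finset.sum_congr rfl fun j _ => ?_
    rw [← mul_assoc]
    congr 1
    rw [← Finset.mul_prod_erase _ _ (Finset.mem_univ j)] at hprod ⊢
    simp only [hD, eval_mul, eval_C, eval_prod, eval_add, eval_one, eval_X]
    have hP := (mul_ne_zero_iff.1 hprod).2
    generalize (∏ i ∈ Finset.univ.erase j, (1 + (p i : ℂ) * (s2 / s1 : ℂ))) = P at *
    have := hj' j
    have e1 : (s1 : ℂ) * s2 * ((1 + (p j : ℂ) * (s2 / s1 : ℂ)) * P) =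
      s2 * (s1 + p j * s2) * P := by field_simp
    rw [e1]
    field_simp
  set H : ℂ → ℂ := fun z => ∑ j, (D j).eval z *
    Complex.exp (-Complex.I * (z * x j + z ^ 2 * y j)) with hH
  have hdiff : Differentiable ℂ H := by
    rw [hH]
    refine Differentiable.fun_sum fun j _ => ?_
    exact (D j).differentiable.mul (by fun_prop)
  have hfin : ∀ t ∈ Ioo a b, t ≠ 0 → (∀ j, 1 + p j * t ≠ 0) → H t = 0 := by
    intro t ht h0 hj
    have h0' : (t : ℂ) ≠ 0 := by exact_mod_cast h0
    obtain ⟨hp, he⟩ := hform t (t ^ 2) h0 (by positivity) (fun j => by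
      have : t + p j * t ^ 2 = t * (1 + p j * t) := by ring
      rw [this]; exact mul_ne_zero h0 (hj j))
    rw [h t ht] at he
    have hdiv : (((t ^ 2 : ℝ) : ℂ) / t) = t := by push_cast; field_simp
    rw [hdiv] at hp he
    have hne : ((t : ℂ) * ((t ^ 2 : ℝ) : ℂ) * ∏ i, (1 + (p i : ℂ) * t))⁻¹ ≠ 0 := by
      refine inv_ne_zero (mul_ne_zero (mul_ne_zero h0' ?_) hp)
      push_cast; positivity
    have := (mul_eq_zero.1 he.symm).resolve_left hne
    rw [hH]
    simp only
    rw [← this]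
    refine Finset.sum_congr rfl fun j _ => ?_
    unfold ek; push_cast; ring_nf
  have hH0 : ∀ z, H z = 0 := by
    set t0 := (a + b) / 2 with ht0
    have hev : ∀ᶠ t in 𝓝[≠] t0, H ((t : ℝ) : ℂ) = 0 := by
      have hI : ∀ᶠ t in 𝓝[≠] t0, t ∈ Ioo a b :=
        nhdsWithin_le_nhds (Ioo_mem_nhds (by linarith) (by linarith))
      have hc : 𝓝[≠] t0 ≤ cofinite := nhdsNE_le_cofinite _
      have hz : ∀ᶠ t in 𝓝[≠] t0, t ≠ 0 := hc (by
        rw [mem_cofinite]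
        exact (finite_singleton (0 : ℝ)).subset (fun t ht => by simpa using ht))
      have hj : ∀ᶠ t in 𝓝[≠] t0, ∀ j, 1 + p j * t ≠ 0 := by
        rw [eventually_all]
        intro j
        apply hc
        rw [mem_cofinite]
        apply Set.Subsingleton.finite
        intro t ht u hu
        simp only [mem_compl_iff, mem_ofPred_eq, not_not] at ht hu
        have hp : p j ≠ 0 := by rintro h0; rw [h0] at ht; norm_num at ht
        exact mul_left_cancel₀ hp (by linarith)
      filter_upwards [hI, hz, hj] with t h1 h2 h3 using hfin t h1 h2 h3
    have htend : Tendsto (fun t : ℝ => (t : ℂ)) (𝓝[≠] t0) (𝓝[≠] (t0 : ℂ)) := by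
      refine tendsto_nhdsWithin_iff.2 ⟨(Complex.continuous_ofReal.tendsto t0).mono_left
        nhdsWithin_le_nhds, ?_⟩
      filter_upwards [self_mem_nhdsWithin] with t ht
      simpa using ht
    have hfr : ∃ᶠ z in 𝓝[≠] (t0 : ℂ), H z = 0 := htend.frequently hev.frequently
    have han : AnalyticOnNhd ℂ H univ := fun z _ => hdiff.analyticAt z
    intro z
    exact han.eqOn_zero_of_preconnected_of_frequently_eq_zero isPreconnected_univ (mem_univ _)
      hfr (mem_univ z)
  set W : Finset (ℝ × ℝ) := Finset.univ.image (fun j => (x j, y j)) with hW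
  set Q : ℝ × ℝ → ℂ[X] := fun v => ∑ j with (x j, y j) = v, D j with hQ
  have hfib : ∀ (z : ℂ) (f : ℝ × ℝ → ℂ), ∑ j, (D j).eval z * f (x j, y j) =
      ∑ v ∈ W, (Q v).eval z * f v := by
    intro z f
    rw [← Finset.sum_fiberwise_of_maps_to (s := Finset.univ) (t := W) (g := fun j => (x j, y j))
      (fun j _ => Finset.mem_image_of_mem _ (Finset.mem_univ j))]
    refine Finset.sum_congr rfl fun v _ => ?_
    rw [hQ]
    simp only [eval_finsetSum, Finset.sum_mul]
    refine Finset.sum_congr rfl fun j hj => ?_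
    rw [(Finset.mem_filter.1 hj).2]
  have hQ0 := linind W Q (fun z => by
    rw [← hfib z (fun v => Complex.exp (-Complex.I * (z * v.1 + z ^ 2 * v.2)))]
    exact hH0 z)
  intro s1 s2 h1 h2 hj
  rw [(hform s1 s2 h1 h2 hj).2, hfib _ (fun v => ek s1 s2 v.1 v.2),
    Finset.sum_eq_zero, mul_zero]
  intro v hv
  rw [hQ0 v hv]; simp

abbrev E2 := EuclideanSpace ℝ (Fin 2)

noncomputable def toE : ℝ × ℝ ≃ᵐ E2 :=
  MeasurableEquiv.finTwoArrow.symm.trans (MeasurableEquiv.toLp 2 (Fin 2 → ℝ))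

lemma toE_mp : MeasurePreserving toE volume volume :=
  ((volume_preserving_finTwoArrow ℝ).symm _).trans (PiLp.volume_preserving_toLp (Fin 2))

lemma toE_zero (z : ℝ × ℝ) : (toE z) 0 = z.1 := rfl
lemma toE_one (z : ℝ × ℝ) : (toE z) 1 = z.2 := rfl

lemma toE_lin (z : ℝ × ℝ) : toE z = z.1 • toE (1, 0) + z.2 • toE (0, 1) := by
  ext i
  fin_cases i
  · show (toE z) 0 = z.1 * (toE (1, 0)) 0 + z.2 * (toE (0, 1)) 0
    simp [toE_zero]
  · show (toE z) 1 = z.1 * (toE (1, 0)) 1 + z.2 * (toE (0, 1)) 1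
    simp [toE_one]

lemma fts_eq (P : Set E2) (s : E2) :
    fourierTransformSet P s = ∫ z in toE ⁻¹' P, ek (s 0) (s 1) z.1 z.2 := by
  unfold fourierTransformSet
  rw [← toE_mp.setIntegral_preimage_emb toE.measurableEmbedding]
  congr 1
  ext z
  unfold ek
  have : (⟪s, toE z⟫ : ℝ) = s 0 * z.1 + s 1 * z.2 := by
    rw [PiLp.inner_apply, Fin.sum_univ_two, toE_zero, toE_one]
    simp [mul_comm]
  rw [this]

lemma ae_eq_set_of_eq {A B : Set (ℝ × ℝ)} (h : A = B) : A =ᵐ[volume] B := by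
  rw [h]
  exact ae_eq_refl _

lemma hull_HP (t : Finset E2) (ht : AffineIndependent ℝ ((↑) : t → E2)) :
    ∃ K, (toE ⁻¹' (convexHull ℝ (t : Set E2)) : Set (ℝ × ℝ)) =ᵐ[volume] HP K := by
  by_cases hspan : affineSpan ℝ (t : Set E2) = ⊤
  · let b : AffineBasis t ℝ E2 := ⟨(↑), ht, by simpa using hspan⟩
    have hb : convexHull ℝ (t : Set E2) = {x | ∀ i, 0 ≤ b.coord i x} := by
      rw [← b.convexHull_eq_nonneg_coord]
      congr 1
      change (t : Set E2) = range ((↑) : t → E2)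
      simp
    refine ⟨(Finset.univ : Finset t).toList.map (fun i => ((b.coord i).linear (toE (1, 0)),
      (b.coord i).linear (toE (0, 1)), b.coord i 0)), ?_⟩
    rw [hb]
    refine ae_eq_set_of_eq ?_
    ext z
    have hz : ∀ i, b.coord i (toE z) = (b.coord i).linear (toE (1, 0)) * z.1 +
        (b.coord i).linear (toE (0, 1)) * z.2 + b.coord i 0 := by
      intro i
      have h1 : b.coord i (toE z) = (b.coord i).linear (toE z) + b.coord i 0 := by
        have := (b.coord i).map_vadd 0 (toE z)
        simpa using this
      rw [h1]
      conv_lhs => rw [toE_lin z]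
      rw [map_add, map_smul, map_smul, smul_eq_mul, smul_eq_mul]
      ring
    simp only [mem_preimage, mem_ofPred_eq, hz, HP, List.mem_map, Finset.mem_toList,
      Finset.mem_univ, true_and, forall_exists_index, forall_apply_eq_imp_iff]
  · refine ⟨[(0, 0, -1)], ?_⟩
    have h0 : HP [(0, 0, -1)] = ∅ := by
      ext z; simp [HP]
    rw [h0, ae_eq_empty, toE_mp.measure_preimage_equiv]
    exact measure_mono_null (convexHull_subset_affineSpan _)
      (Measure.addHaar_affineSubspace volume _ hspan)

lemma inter_HP {ι : Type*} (u : Finset ι) (A : ι → Set (ℝ × ℝ))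
    (h : ∀ i ∈ u, ∃ K, A i =ᵐ[volume] HP K) :
    ∃ K, (⋂ i ∈ u, A i : Set (ℝ × ℝ)) =ᵐ[volume] HP K := by
  classical
  induction u using Finset.induction_on with
  | empty => exact ⟨[], by simp [HP]⟩
  | insert i u hi ih =>
    obtain ⟨K, hK⟩ := h i (by simp)
    obtain ⟨K', hK'⟩ := ih fun j hj => h j (by simp [hj])
    refine ⟨K ++ K', ?_⟩
    have : HP (K ++ K') = HP K ∩ HP K' := by
      ext z; simp [HP, or_imp, forall_and]
    rw [this, Finset.set_biInter_insert]
    exact hK.inter hK'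

lemma IsConvexPolytope.compact {P : Set E2} (h : IsConvexPolytope P) : IsCompact P := by
  obtain ⟨V, rfl, -⟩ := h
  exact V.finite_toSet.isCompact_convexHull (𝕜 := ℝ)

lemma IsGenPolytope.compact {P : Set E2} (h : IsGenPolytope P) : IsCompact P := by
  obtain ⟨m, Q, hQ, rfl⟩ := h
  exact isCompact_iUnion fun i => (hQ i).compact

lemma IsGenPolytope.subset_closure_interior {P : Set E2} (h : IsGenPolytope P) :
    P ⊆ closure (interior P) := by
  obtain ⟨m, Q, hQ, rfl⟩ := h
  refine iUnion_subset fun i => ?_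
  have hc := (hQ i).compact.isClosed
  obtain ⟨V, hV, hn⟩ := hQ i
  have hconv : Convex ℝ (Q i) := by rw [hV]; exact convex_convexHull ℝ _
  have := hconv.closure_interior_eq_closure_of_nonempty_interior hn
  calc Q i ⊆ closure (Q i) := subset_closure
    _ = closure (interior (Q i)) := this.symm
    _ ⊆ _ := closure_mono (interior_mono (subset_iUnion Q i))

lemma IsGenPolytope.triangles {P : Set E2} (h : IsGenPolytope P) :
    ∃ T : Finset (Finset E2), (∀ t ∈ T, AffineIndependent ℝ ((↑) : t → E2)) ∧
      P = ⋃ t ∈ T, convexHull ℝ (t : Set E2) := by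
  classical
  obtain ⟨m, Q, hQ, rfl⟩ := h
  choose V hV hn using hQ
  refine ⟨Finset.univ.biUnion fun i => (V i).powerset.filter
    (fun t => AffineIndependent ℝ ((↑) : t → E2)), ?_, ?_⟩
  · intro t ht
    simp only [Finset.mem_biUnion, Finset.mem_filter] at ht
    obtain ⟨i, -, -, h⟩ := ht
    exact h
  · ext x
    simp only [mem_iUnion, Finset.mem_biUnion, Finset.mem_filter, Finset.mem_univ, true_and,
      Finset.mem_powerset, exists_prop]
    constructor
    · rintro ⟨i, hx⟩
      rw [hV i, convexHull_eq_union] at hx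
      simp only [mem_iUnion, exists_prop] at hx
      obtain ⟨t, h1, h2, h3⟩ := hx
      exact ⟨t, ⟨i, by exact_mod_cast h1, h2⟩, h3⟩
    · rintro ⟨t, ⟨i, h1, h2⟩, h3⟩
      refine ⟨i, ?_⟩
      rw [hV i]
      exact convexHull_mono (by exact_mod_cast h1) h3

lemma IsGenPolytope.expRat {P : Set E2} (h : IsGenPolytope P) :
    ExpRat (fun s1 s2 => ∫ z in toE ⁻¹' P, ek s1 s2 z.1 z.2) := by
  classical
  obtain ⟨M, hM⟩ : ∃ M : ℝ, toE ⁻¹' P ⊆ Icc (-M, -M) (M, M) := by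
    obtain ⟨M, hM⟩ := h.compact.isBounded.exists_norm_le
    refine ⟨M, fun z hz => ?_⟩
    have h0 := (PiLp.norm_apply_le (toE z) 0).trans (hM _ hz)
    have h1 := (PiLp.norm_apply_le (toE z) 1).trans (hM _ hz)
    rw [toE_zero, Real.norm_eq_abs, abs_le] at h0
    rw [toE_one, Real.norm_eq_abs, abs_le] at h1
    exact ⟨⟨h0.1, h1.1⟩, ⟨h0.2, h1.2⟩⟩
  obtain ⟨T, hT, hP⟩ := h.triangles
  set A : Finset E2 → Set (ℝ × ℝ) := fun t => toE ⁻¹' (convexHull ℝ (t : Set E2)) with hA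
  have hPA : toE ⁻¹' P = ⋃ t ∈ T, A t := by
    rw [hP]; simp only [preimage_iUnion, hA]
  have hAsub : ∀ t ∈ T, A t ⊆ Icc (-M, -M) (M, M) := fun t ht =>
    (hPA ▸ subset_biUnion_of_mem (u := A) (show t ∈ {t | t ∈ T} from ht)).trans hM
  have hAm : ∀ t ∈ T, MeasurableSet (A t) := fun t _ =>
    (t.finite_toSet.isCompact_convexHull (𝕜 := ℝ)).isClosed.measurableSet.preimage toE.measurable
  have hmain : ∀ s1 s2 : ℝ, ∫ z in toE ⁻¹' P, ek s1 s2 z.1 z.2 =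
      ∑ u ∈ T.powerset with u.Nonempty,
        (((-1 : ℝ) ^ (u.card + 1) : ℝ) : ℂ) * ∫ z in ⋂ t ∈ u, A t, ek s1 s2 z.1 z.2 := by
    intro s1 s2
    rw [hPA, integral_biUnion_eq_sum_powerset hAm fun t ht => ek_intOn s1 s2 M (hAsub t ht)]
    simp only [Complex.real_smul]
  simp only [hmain]
  apply ExpRat.sum
  intro u hu
  apply ExpRat.smul
  rw [Finset.mem_filter, Finset.mem_powerset] at hu
  obtain ⟨K, hK⟩ := inter_HP u A fun t ht => hull_HP t (hT t (hu.1 ht))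
  refine expRat_of_ae_HP (M := M) ?_ K hK
  obtain ⟨t, ht⟩ := hu.2
  exact (biInter_subset_of_mem (t := A) (show t ∈ {t | t ∈ u} from ht)).trans (hAsub t (hu.1 ht))

lemma ae_lin_ne (a b : ℝ) (h : a ≠ 0 ∨ b ≠ 0) : ∀ᵐ s : E2, a * s 0 + b * s 1 ≠ 0 := by
  let L : E2 →ₗ[ℝ] ℝ :=
    { toFun := fun s => a * s 0 + b * s 1
      map_add' := fun s t => by simp; ring
      map_smul' := fun r s => by simp; ring }
  have hL : LinearMap.ker L ≠ ⊤ := by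
    intro htop
    have h1 : ∀ v : E2, L v = 0 := fun v => by
      have : v ∈ LinearMap.ker L := htop ▸ Submodule.mem_top
      exact this
    have ha : a = 0 := by
      have : a * (toE (1, 0)) 0 + b * (toE (1, 0)) 1 = 0 := h1 (toE (1, 0))
      simpa [toE_zero, toE_one] using this
    have hb : b = 0 := by
      have : a * (toE (0, 1)) 0 + b * (toE (0, 1)) 1 = 0 := h1 (toE (0, 1))
      simpa [toE_zero, toE_one] using this
    tauto
  have := Measure.addHaar_submodule (volume : Measure E2) _ hL
  rw [ae_iff]
  refine measure_mono_null (fun s hs => ?_) this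
  simp only [mem_ofPred_eq, not_not] at hs
  exact hs

lemma subset_of_restrict_eq {P₁ P₂ : Set E2} (h₁ : IsGenPolytope P₁) (h₂ : IsGenPolytope P₂)
    (h : (volume : Measure E2).restrict P₁ = (volume : Measure E2).restrict P₂) : P₁ ⊆ P₂ := by
  have hm2 := h₂.compact.isClosed
  have hnull : volume (interior P₁ \ P₂) = 0 := by
    have h3 : (volume : Measure E2).restrict P₂ (interior P₁ \ P₂) = 0 := by
      rw [Measure.restrict_apply (isOpen_interior.measurableSet.diff hm2.measurableSet)]
      simp
    rw [← h, Measure.restrict_apply (isOpen_interior.measurableSet.diff hm2.measurableSet)] at h3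
    rwa [inter_eq_self_of_subset_left (sdiff_subset.trans interior_subset)] at h3
  have hemp : interior P₁ \ P₂ = ∅ :=
    ((isOpen_interior.sdiff hm2).measure_eq_zero_iff volume).1 hnull
  exact h₁.subset_closure_interior.trans
    (hm2.closure_subset_iff.2 (sdiff_eq_empty.1 hemp))

/-- Two generalized `2`-dimensional polytopes whose Fourier transforms
agree on the parabola arc `σ(I)`, `σ(t) = (t, t²)`, for a nonempty open interval `I`
avoiding `0`, coincide. -/
theorem fourier_eq_on_parabola_arc_implies_eq
    (P₁ P₂ : Set (EuclideanSpace ℝ (Fin 2)))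
    (hP₁ : IsGenPolytope P₁) (hP₂ : IsGenPolytope P₂)
    (I : Set ℝ) (a b : ℝ) (hab : a < b) (hI : I = Set.Ioo a b)
    (h0 : (0 : ℝ) ∉ I)
    (σ : ℝ → EuclideanSpace ℝ (Fin 2))
    (hσ : ∀ t : ℝ, σ t = (WithLp.equiv 2 (Fin 2 → ℝ)).symm ![t, t ^ 2])
    (heq : ∀ t ∈ I, fourierTransformSet P₁ (σ t) = fourierTransformSet P₂ (σ t)) :
    P₁ = P₂ := by
  subst hI
  obtain ⟨ι, _, p, hvan⟩ := expRat_vanish (hP₁.expRat.add (hP₂.expRat.smul (-1))) hab (by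
    intro t ht
    have := heq t ht
    rw [fts_eq, fts_eq, hσ] at this
    simp only [WithLp.equiv_symm_apply, PiLp.toLp_apply, Matrix.cons_val_zero,
      Matrix.cons_val_one] at this
    rw [this]; ring)
  have f1 : IsFiniteMeasure ((volume : Measure E2).restrict P₁) :=
    ⟨by simpa using hP₁.compact.measure_lt_top⟩
  have f2 : IsFiniteMeasure ((volume : Measure E2).restrict P₂) :=
    ⟨by simpa using hP₂.compact.measure_lt_top⟩
  have hcf : ∀ (P : Set E2) (s : E2),
      charFun ((volume : Measure E2).restrict P) s = fourierTransformSet P (-s) := by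
    intro P s
    rw [charFun_apply]
    unfold fourierTransformSet
    congr 1
    ext x
    rw [inner_neg_left, real_inner_comm]
    push_cast
    ring_nf
  have hmeas : (volume : Measure E2).restrict P₁ = (volume : Measure E2).restrict P₂ := by
    apply Measure.ext_of_charFun
    rw [← Continuous.ae_eq_iff_eq (volume : Measure E2) continuous_charFun continuous_charFun]
    have hj : ∀ᵐ s : E2, ∀ j, 1 * s 0 + p j * s 1 ≠ 0 :=
      ae_all_iff.2 fun j => ae_lin_ne 1 (p j) (by simp)
    filter_upwards [ae_lin_ne 1 0 (by simp), ae_lin_ne 0 1 (by simp), hj] with s h1 h2 h3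
    rw [hcf, hcf, fts_eq, fts_eq]
    have := hvan ((-s) 0) ((-s) 1) (by simpa using h1) (by simpa using h2) (fun j hj => h3 j (by
      simp only [PiLp.neg_apply] at hj
      linarith))
    linear_combination this
  exact (subset_of_restrict_eq hP₁ hP₂ hmeas).antisymm (subset_of_restrict_eq hP₂ hP₁ hmeas.symm)
end

section
/- Let 𝒫₁ and 𝒫₂ be generalized 2-dimensional polytopes in ℝ², let I be a nonempty open interval in ℝ with 0 ∉ I, and let σ(t) = (t, 1/t) (a parameterization of the hyperbola). If F_{𝒫₁}(σ(t)) = F_{𝒫₂}(σ(t)) for every t ∈ I, then 𝒫₁ = 𝒫₂. -/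
open scoped RealInnerProductSpace

open Polynomial in
lemma hyp_poly_core (p r : ℂ[X]) (hp : p ≠ 0) (hr : r ≠ 0) (α β : ℂ)
    (h : X ^ 2 * (p * derivative r - derivative p * r) + (C α * X ^ 2 + C β) * (p * r) = 0) :
    α = 0 ∧ β = 0 := by
  have hα : α = 0 := by
    by_contra hα
    have h1 : ∀ m, p.natDegree + r.natDegree ≤ m → (p * derivative r - derivative p * r).coeff m = 0 := by
      intro m hm
      by_cases hw : wronskian p r = 0
      · rw [wronskian] at hw; rw [hw]; simp
      · apply coeff_eq_zero_of_natDegree_lt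
        exact lt_of_lt_of_le (natDegree_wronskian_lt_add hw) hm
    have h2 := congrArg (fun q => coeff q (p.natDegree + r.natDegree + 2)) h
    simp only [coeff_add, coeff_zero, add_mul, mul_assoc, coeff_C_mul] at h2
    rw [coeff_X_pow_mul, coeff_X_pow_mul, h1 _ le_rfl, coeff_mul_degree_add_degree,
      coeff_eq_zero_of_natDegree_lt (p := p * r)] at h2
    · simp [hα, hp, hr] at h2
    · have := natDegree_mul_le (p := p) (q := r)
      omega
  refine ⟨hα, ?_⟩
  subst hα
  obtain ⟨P, hP, hP0⟩ := exists_eq_pow_rootMultiplicity_mul_and_not_dvd p hp 0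
  obtain ⟨R, hR, hR0⟩ := exists_eq_pow_rootMultiplicity_mul_and_not_dvd r hr 0
  generalize rootMultiplicity 0 p = a at hP
  generalize rootMultiplicity 0 r = b at hR
  simp only [C_0, sub_zero, X_dvd_iff, coeff_zero_eq_eval_zero] at hP hR hP0 hR0
  have key : ∀ (n : ℕ) (Q : ℂ[X]), X * derivative (X ^ n * Q) = X ^ n * (C (n : ℂ) * Q + X * derivative Q) := by
    intro n Q
    rw [derivative_mul, derivative_X_pow]
    rcases n with _ | n
    · simp
    · simp only [Nat.add_sub_cancel]; ring
  have h3 : X ^ (a + b) * (X * (P * (C (b : ℂ) * R + X * derivative R) - R * (C (a : ℂ) * P + X * derivative P)) + C β * (P * R)) = 0 := by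
    rw [← h, hP, hR]
    have e1 : X ^ 2 * (X ^ a * P * derivative (X ^ b * R) - derivative (X ^ a * P) * (X ^ b * R))
       = X * (X ^ a * P * (X * derivative (X ^ b * R)) - (X * derivative (X ^ a * P)) * (X ^ b * R)) := by ring
    rw [e1, key, key]
    simp only [C_0]
    ring
  have h4 := (mul_eq_zero.1 h3).resolve_left (pow_ne_zero _ X_ne_zero)
  have h5 := congrArg (eval 0) h4
  simpa [hP0, hR0] using h5

open Polynomial in
lemma hyp_lin_indep (a b : ℝ) (hab : a < b) (h0 : (0:ℝ) ∉ Set.Ioo a b)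
    (V : Finset (EuclideanSpace ℝ (Fin 2))) :
    ∀ p : EuclideanSpace ℝ (Fin 2) → ℂ[X],
    (∀ t ∈ Set.Ioo a b, ∑ v ∈ V, (p v).eval (t : ℂ) *
      Complex.exp (-Complex.I * (((v 0 * t + v 1 / t : ℝ)) : ℂ)) = 0) → ∀ v ∈ V, p v = 0 := by
  have hzero : ∀ q : ℂ[X], (∀ t ∈ Set.Ioo a b, q.eval (t : ℂ) = 0) → q = 0 := by
    intro q hq
    apply eq_zero_of_infinite_isRoot
    apply Set.Infinite.mono (s := (fun t : ℝ => (t : ℂ)) '' Set.Ioo a b)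
    · rintro _ ⟨t, ht, rfl⟩
      exact hq t ht
    · exact (Set.Ioo_infinite hab).image Complex.ofReal_injective.injOn
  classical
  induction V using Finset.induction_on with
  | empty => simp
  | insert w V hw ih =>
    intro p hp
    by_cases hpw : p w = 0
    · have := ih p (by
        intro t ht
        have := hp t ht
        rwa [Finset.sum_insert hw, hpw, eval_zero, zero_mul, zero_add] at this)
      intro v hv
      rcases Finset.mem_insert.1 hv with rfl | hv
      · exact hpw
      · exact this v hv
    · set q : EuclideanSpace ℝ (Fin 2) → ℂ[X] := fun v =>
        X ^ 2 * (p w * derivative (p v) - derivative (p w) * p v) +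
        (C (-Complex.I * ((v 0 - w 0 : ℝ) : ℂ)) * X ^ 2 + C (Complex.I * ((v 1 - w 1 : ℝ) : ℂ))) * (p w * p v) with hq
      have hder : ∀ (v : EuclideanSpace ℝ (Fin 2)) (t : ℝ), t ≠ 0 → HasDerivAt (fun t : ℝ => (p v).eval (t : ℂ) *
          Complex.exp (-Complex.I * (((v 0 * t + v 1 / t : ℝ)) : ℂ)))
          (((derivative (p v)).eval (t : ℂ) + (p v).eval (t : ℂ) * (-Complex.I * ((v 0 - v 1 / t ^ 2 : ℝ) : ℂ))) *
          Complex.exp (-Complex.I * (((v 0 * t + v 1 / t : ℝ)) : ℂ))) t := by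
        intro v t ht
        have h1 : HasDerivAt (fun t : ℝ => (p v).eval (t : ℂ)) ((derivative (p v)).eval (t : ℂ)) t :=
          ((p v).hasDerivAt (t : ℂ)).comp_ofReal
        have h2 : HasDerivAt (fun t : ℝ => v 0 * t + v 1 / t) (v 0 - v 1 / t ^ 2) t := by
          have := ((hasDerivAt_id t).const_mul (v 0)).add ((hasDerivAt_inv ht).const_mul (v 1))
          simp only [div_eq_mul_inv]
          exact this.congr_deriv (by ring)
        have h3 := ((h2.ofReal_comp).const_mul (-Complex.I)).cexp
        exact (h1.mul h3).congr_deriv (by ring)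
      have hq0 : q w = 0 := by simp only [hq]; simp; ring
      have hV : ∀ v ∈ V, q v = 0 := by
        apply ih
        intro t ht
        have ht0 : t ≠ 0 := by rintro rfl; exact h0 ht
        have htc : (t : ℂ) ≠ 0 := by exact_mod_cast ht0
        have hd := HasDerivAt.fun_sum (u := insert w V) (fun v _ => hder v t ht0)
        have hd0 : HasDerivAt (fun t : ℝ => ∑ v ∈ insert w V, (p v).eval (t : ℂ) *
            Complex.exp (-Complex.I * (((v 0 * t + v 1 / t : ℝ)) : ℂ))) 0 t := by
          apply (hasDerivAt_const t (0:ℂ)).congr_of_eventuallyEq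
          filter_upwards [isOpen_Ioo.mem_nhds ht] with t ht using hp t ht
        have hD := hd.unique hd0
        have hp' := hp t ht
        have key : ∑ v ∈ insert w V, (q v).eval (t : ℂ) * Complex.exp (-Complex.I * (((v 0 * t + v 1 / t : ℝ)) : ℂ))
          = (t : ℂ) ^ 2 * (p w).eval (t : ℂ) * 0 - (t : ℂ) ^ 2 * ((derivative (p w)).eval (t : ℂ) + (p w).eval (t : ℂ) * (-Complex.I * ((w 0 - w 1 / t ^ 2 : ℝ) : ℂ))) * 0 := by
          conv_rhs => enter [1]; rw [← hD]
          conv_rhs => enter [2]; rw [← hp']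
          rw [Finset.mul_sum, Finset.mul_sum, ← Finset.sum_sub_distrib]
          apply Finset.sum_congr rfl
          intro v _
          simp only [hq, eval_add, eval_mul, eval_sub, eval_pow, eval_X, eval_C]
          push_cast
          field_simp
          ring
        rw [Finset.sum_insert hw, hq0, eval_zero, zero_mul, zero_add] at key
        rw [key]; ring
      have hpV : ∀ v ∈ V, p v = 0 := by
        intro v hv
        by_contra hpv
        have := hyp_poly_core (p w) (p v) hpw hpv _ _ (hV v hv)
        simp only [mul_eq_zero, neg_eq_zero, Complex.I_ne_zero, false_or, Complex.ofReal_eq_zero] at this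
        have hvw : v = w := by
          ext i; fin_cases i
          · exact sub_eq_zero.1 this.1
          · exact sub_eq_zero.1 this.2
        exact hw (hvw ▸ hv)
      exfalso
      apply hpw
      apply hzero
      intro t ht
      have := hp t ht
      rw [Finset.sum_insert hw, Finset.sum_eq_zero (by intro v hv; rw [hpV v hv]; simp), add_zero] at this
      simpa [Complex.exp_ne_zero] using this

open MeasureTheory in
lemma hyp_simplex_integral (P Q : ℝ) :
    (Complex.I * Q) * (Complex.I * P) * (Complex.I * (P - Q)) *
      ∫ y : ℝ × ℝ, Set.indicator {y : ℝ × ℝ | 0 ≤ y.1 ∧ 0 ≤ y.2 ∧ y.1 + y.2 ≤ 1}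
        (fun y => Complex.exp (-Complex.I * ((y.1 * P + y.2 * Q : ℝ) : ℂ))) y
     = Complex.I * (P - Q) + Complex.I * Q * Complex.exp (-Complex.I * P)
        - Complex.I * P * Complex.exp (-Complex.I * Q) := by
  have base : ∀ (x d : ℝ), (Complex.I * x) * ∫ v in (0:ℝ)..d, Complex.exp (-Complex.I * ((v * x : ℝ) : ℂ))
      = 1 - Complex.exp (-Complex.I * ((d * x : ℝ) : ℂ)) := by
    intro x d
    rw [← intervalIntegral.integral_const_mul]
    have hd : ∀ v ∈ Set.uIcc (0:ℝ) d, HasDerivAt (fun v : ℝ => -Complex.exp (-Complex.I * ((v * x : ℝ) : ℂ)))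
        ((Complex.I * x) * Complex.exp (-Complex.I * ((v * x : ℝ) : ℂ))) v := by
      intro v _
      have h2 : HasDerivAt (fun v : ℝ => v * x) (1 * x) v := (hasDerivAt_id v).mul_const x
      have h3 := ((h2.ofReal_comp).const_mul (-Complex.I)).cexp.neg
      exact h3.congr_deriv (by push_cast; ring)
    rw [intervalIntegral.integral_eq_sub_of_hasDerivAt hd]
    · simp; ring
    · apply Continuous.intervalIntegrable
      fun_prop
  have hcl : IsClosed {y : ℝ × ℝ | 0 ≤ y.1 ∧ 0 ≤ y.2 ∧ y.1 + y.2 ≤ 1} := by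
    have h1 : IsClosed {y : ℝ × ℝ | 0 ≤ y.1} := isClosed_le continuous_const continuous_fst
    have h2 : IsClosed {y : ℝ × ℝ | 0 ≤ y.2} := isClosed_le continuous_const continuous_snd
    have h3 : IsClosed {y : ℝ × ℝ | y.1 + y.2 ≤ 1} := isClosed_le (by fun_prop) continuous_const
    exact h1.inter (h2.inter h3)
  have hint : Integrable (Set.indicator {y : ℝ × ℝ | 0 ≤ y.1 ∧ 0 ≤ y.2 ∧ y.1 + y.2 ≤ 1}
        (fun y => Complex.exp (-Complex.I * ((y.1 * P + y.2 * Q : ℝ) : ℂ)))) (volume : Measure (ℝ × ℝ)) := by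
    rw [integrable_indicator_iff hcl.measurableSet]
    apply ContinuousOn.integrableOn_compact
    · apply (isCompact_Icc (a := ((0:ℝ),(0:ℝ))) (b := (1,1))).of_isClosed_subset hcl
      rintro ⟨u, v⟩ ⟨h1, h2, h3⟩
      simp only at h1 h2 h3
      exact ⟨⟨h1, h2⟩, ⟨by simp only; linarith, by simp only; linarith⟩⟩
    · apply Continuous.continuousOn; fun_prop
  have hI : ∫ y : ℝ × ℝ, Set.indicator {y : ℝ × ℝ | 0 ≤ y.1 ∧ 0 ≤ y.2 ∧ y.1 + y.2 ≤ 1}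
        (fun y => Complex.exp (-Complex.I * ((y.1 * P + y.2 * Q : ℝ) : ℂ))) y
      = ∫ u in (0:ℝ)..1, Complex.exp (-Complex.I * ((u * P : ℝ) : ℂ)) * ∫ v in (0:ℝ)..(1-u), Complex.exp (-Complex.I * ((v * Q : ℝ) : ℂ)) := by
    rw [Measure.volume_eq_prod] at hint ⊢
    rw [integral_prod _ hint, intervalIntegral.integral_of_le zero_le_one, ← integral_Icc_eq_integral_Ioc,
      ← integral_indicator measurableSet_Icc]
    congr 1
    ext u
    by_cases hu : u ∈ Set.Icc (0:ℝ) 1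
    · rw [Set.indicator_of_mem hu, intervalIntegral.integral_of_le (by linarith [hu.2]), ← integral_Icc_eq_integral_Ioc,
        ← integral_const_mul, ← integral_indicator measurableSet_Icc]
      congr 1
      ext v
      by_cases hv : v ∈ Set.Icc (0:ℝ) (1-u)
      · rw [Set.indicator_of_mem hv, Set.indicator_of_mem, ← Complex.exp_add]
        · congr 1; push_cast; ring
        · exact ⟨hu.1, hv.1, by have := hv.2; simp only; linarith⟩
      · rw [Set.indicator_of_notMem hv, Set.indicator_of_notMem]
        rintro ⟨h1, h2, h3⟩
        exact hv ⟨h2, by simp only at h3; linarith⟩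
    · rw [Set.indicator_of_notMem hu]
      apply integral_eq_zero_of_ae
      apply Filter.Eventually.of_forall
      intro v
      apply Set.indicator_of_notMem
      rintro ⟨h1, h2, h3⟩
      simp only at h1 h2 h3
      exact hu ⟨h1, by linarith⟩
  have h1 : (Complex.I * Q) * ∫ u in (0:ℝ)..1, Complex.exp (-Complex.I * ((u * P : ℝ) : ℂ)) * ∫ v in (0:ℝ)..(1-u), Complex.exp (-Complex.I * ((v * Q : ℝ) : ℂ))
      = (∫ u in (0:ℝ)..1, Complex.exp (-Complex.I * ((u * P : ℝ) : ℂ))) -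
        Complex.exp (-Complex.I * Q) * ∫ u in (0:ℝ)..1, Complex.exp (-Complex.I * ((u * (P - Q) : ℝ) : ℂ)) := by
    rw [← intervalIntegral.integral_const_mul, ← intervalIntegral.integral_const_mul, ← intervalIntegral.integral_sub]
    · congr 1
      ext u
      rw [mul_left_comm, base, mul_sub, mul_one, ← Complex.exp_add, ← Complex.exp_add]
      congr 2
      push_cast; ring
    · apply Continuous.intervalIntegrable; fun_prop
    · apply Continuous.intervalIntegrable; fun_prop
  have b1 := base P 1
  have b2 := base (P - Q) 1
  have e1 : Complex.exp (-Complex.I * Q) * Complex.exp (-Complex.I * ((1 * (P - Q) : ℝ) : ℂ)) = Complex.exp (-Complex.I * P) := by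
    rw [← Complex.exp_add]; congr 1; push_cast; ring
  rw [hI]
  calc _ = (Complex.I * P) * (Complex.I * (P - Q)) * ((Complex.I * Q) * ∫ u in (0:ℝ)..1, Complex.exp (-Complex.I * ((u * P : ℝ) : ℂ)) * ∫ v in (0:ℝ)..(1-u), Complex.exp (-Complex.I * ((v * Q : ℝ) : ℂ))) := by ring
    _ = (Complex.I * (P - Q)) * ((Complex.I * P) * (∫ u in (0:ℝ)..1, Complex.exp (-Complex.I * ((u * P : ℝ) : ℂ)))) -
        (Complex.I * P) * Complex.exp (-Complex.I * Q) * ((Complex.I * ((P - Q : ℝ) : ℂ)) * ∫ u in (0:ℝ)..1, Complex.exp (-Complex.I * ((u * (P - Q) : ℝ) : ℂ))) := by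
          rw [h1]; push_cast; ring
    _ = _ := by
          rw [b1, b2, ← e1]
          have e2 : ((1 * P : ℝ) : ℂ) = P := by simp
          rw [e2, ← e1]
          ring

/-- The plane. -/
abbrev HypE := EuclideanSpace ℝ (Fin 2)

/-- A triangle. -/
def hypTri (a b c : HypE) : Set HypE := convexHull ℝ {a, b, c}

lemma mem_hypTri {a b c x : HypE} : x ∈ hypTri a b c ↔
    ∃ u v : ℝ, 0 ≤ u ∧ 0 ≤ v ∧ u + v ≤ 1 ∧ x = a + (u • (b - a) + v • (c - a)) := by
  constructor
  · intro hx
    have hsub : hypTri a b c ⊆ {x | ∃ u v : ℝ, 0 ≤ u ∧ 0 ≤ v ∧ u + v ≤ 1 ∧ x = a + (u • (b - a) + v • (c - a))} := by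
      apply convexHull_min
      · rintro x (rfl | rfl | rfl)
        · exact ⟨0, 0, by simp⟩
        · exact ⟨1, 0, by simp⟩
        · exact ⟨0, 1, by simp⟩
      · rintro x ⟨u, v, hu, hv, huv, rfl⟩ y ⟨u', v', hu', hv', huv', rfl⟩ s t hs ht hst
        refine ⟨s * u + t * u', s * v + t * v', by positivity, by positivity, by nlinarith, ?_⟩
        obtain rfl : s = 1 - t := by linarith
        module
    exact hsub hx
  · rintro ⟨u, v, hu, hv, huv, rfl⟩
    have := (convex_convexHull ℝ ({a, b, c} : Set HypE)).sum_mem (t := (Finset.univ : Finset (Fin 3)))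
      (w := ![1 - u - v, u, v]) (z := ![a, b, c]) (by
        intro i _; fin_cases i
        · simp; linarith
        · simpa
        · simpa) (by simp [Fin.sum_univ_three]; ring) (by
        intro i _; apply subset_convexHull; fin_cases i <;> simp)
    have e : a + (u • (b - a) + v • (c - a)) = ∑ i : Fin 3, (![1 - u - v, u, v] : Fin 3 → ℝ) i • (![a, b, c] : Fin 3 → HypE) i := by
      simp [Fin.sum_univ_three]; module
    rw [e]; exact this

lemma hypTri_cut (a b c : HypE) (l : HypE →ₗ[ℝ] ℝ) (k : ℝ) (ha : 0 < l a + k) (hb : l b + k ≤ 0) (hc : l c + k ≤ 0) :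
    ∃ p q, hypTri a b c ∩ {x | 0 ≤ l x + k} = hypTri a p q := by
  set ga := l a + k with hga
  set gb := l b + k with hgb
  set gc := l c + k with hgc
  have hlb : l b - l a = gb - ga := by simp [hga, hgb]
  have hlc : l c - l a = gc - ga := by simp [hga, hgc]
  have h1 : 0 < ga - gb := by linarith
  have h2 : 0 < ga - gc := by linarith
  refine ⟨a + (ga / (ga - gb)) • (b - a), a + (ga / (ga - gc)) • (c - a), ?_⟩
  ext x
  rw [Set.mem_inter_iff, mem_hypTri, mem_hypTri, Set.mem_ofPred_eq]
  constructor
  · rintro ⟨⟨u, v, hu, hv, huv, rfl⟩, hx⟩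
    simp only [map_add, map_smul, map_sub, smul_eq_mul, hlb, hlc] at hx
    refine ⟨u * ((ga - gb) / ga), v * ((ga - gc) / ga), by positivity, by positivity, ?_, ?_⟩
    · rw [← mul_div_assoc, ← mul_div_assoc, ← add_div, div_le_one ha]
      linarith
    · have e1 : u * ((ga - gb) / ga) * (ga / (ga - gb)) = u := by field_simp
      have e2 : v * ((ga - gc) / ga) * (ga / (ga - gc)) = v := by field_simp
      simp only [add_sub_cancel_left, smul_smul, e1, e2]
  · rintro ⟨u, v, hu, hv, huv, rfl⟩
    have t1 : ga / (ga - gb) ≤ 1 := by rw [div_le_one h1]; linarith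
    have t2 : ga / (ga - gc) ≤ 1 := by rw [div_le_one h2]; linarith
    have e1 : ga / (ga - gb) * (gb - ga) = - ga := by field_simp; ring
    have e2 : ga / (ga - gc) * (gc - ga) = - ga := by field_simp; ring
    refine ⟨⟨u * (ga / (ga - gb)), v * (ga / (ga - gc)), by positivity, by positivity, ?_, ?_⟩, ?_⟩
    · nlinarith
    · simp only [add_sub_cancel_left, smul_smul]
    · simp only [add_sub_cancel_left, map_add, map_smul, map_sub, smul_eq_mul, hlb, hlc, e1, e2]
      nlinarith

lemma hypTri_apply {a b c x : HypE} (l : HypE →ₗ[ℝ] ℝ) (k : ℝ) (hx : x ∈ hypTri a b c) :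
    ∃ r u v : ℝ, 0 ≤ r ∧ 0 ≤ u ∧ 0 ≤ v ∧ r + u + v = 1 ∧ l x + k = r * (l a + k) + u * (l b + k) + v * (l c + k) := by
  obtain ⟨u, v, hu, hv, huv, rfl⟩ := mem_hypTri.1 hx
  refine ⟨1 - u - v, u, v, by linarith, hu, hv, by ring, ?_⟩
  simp only [map_add, map_smul, map_sub, smul_eq_mul]
  ring

open MeasureTheory in
lemma hyp_line_null (l : HypE →ₗ[ℝ] ℝ) (k : ℝ) (hl : l ≠ 0) :
    volume {x | l x + k = 0} = 0 := by
  by_cases hne : ∃ x0, l x0 + k = 0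
  · obtain ⟨x0, hx0⟩ := hne
    have hs : {x | l x + k = 0} ⊆ (AffineSubspace.mk' x0 (LinearMap.ker l) : Set HypE) := by
      intro x hx
      rw [SetLike.mem_coe, AffineSubspace.mem_mk', LinearMap.mem_ker, vsub_eq_sub, map_sub]
      have : l x + k = 0 := hx
      linarith
    apply measure_mono_null hs
    apply Measure.addHaar_affineSubspace
    intro h
    have := congrArg AffineSubspace.direction h
    rw [AffineSubspace.direction_mk', AffineSubspace.direction_top, LinearMap.ker_eq_top] at this
    exact hl this
  · have : {x | l x + k = 0} = ∅ := by
      ext x; simp only [Set.mem_ofPred_eq, Set.mem_empty_iff_false, iff_false]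
      exact fun h => hne ⟨x, h⟩
    rw [this]; simp

open MeasureTheory in
lemma hypTri_null (a b c : HypE) (h : ¬ LinearIndependent ℝ ![b - a, c - a]) :
    volume (hypTri a b c) = 0 := by
  have hs : hypTri a b c ⊆ (AffineSubspace.mk' a (Submodule.span ℝ (Set.range ![b - a, c - a])) : Set HypE) := by
    intro x hx
    obtain ⟨u, v, hu, hv, huv, rfl⟩ := mem_hypTri.1 hx
    rw [SetLike.mem_coe, AffineSubspace.mem_mk', vsub_eq_sub, add_sub_cancel_left]
    apply Submodule.add_mem
    · apply Submodule.smul_mem; apply Submodule.subset_span; exact ⟨0, rfl⟩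
    · apply Submodule.smul_mem; apply Submodule.subset_span; exact ⟨1, rfl⟩
  apply measure_mono_null hs
  apply Measure.addHaar_affineSubspace
  intro h'
  have := congrArg AffineSubspace.direction h'
  rw [AffineSubspace.direction_mk', AffineSubspace.direction_top] at this
  apply h
  apply linearIndependent_of_top_le_span_of_card_eq_finrank this.ge
  simp

lemma hypTri_isCompact (a b c : HypE) : IsCompact (hypTri a b c) :=
  Set.Finite.isCompact_convexHull (𝕜 := ℝ) (Set.toFinite _)

open MeasureTheory in
/-- Span of indicators of triangles, modulo null functions. -/
noncomputable def hypS : Submodule ℂ (HypE → ℂ) :=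
  Submodule.span ℂ ({f | ∃ a b c, f = (hypTri a b c).indicator 1} ∪ {f | f =ᵐ[volume] 0})

open MeasureTheory in
lemma hypS_null {f : HypE → ℂ} (h : f =ᵐ[volume] 0) : f ∈ hypS :=
  Submodule.subset_span (Or.inr h)

open MeasureTheory in
lemma hypS_congr {f g : HypE → ℂ} (h : f =ᵐ[volume] g) (hg : g ∈ hypS) : f ∈ hypS := by
  have : f = (f - g) + g := by simp
  rw [this]
  apply Submodule.add_mem _ (hypS_null _) hg
  filter_upwards [h] with x hx
  simp [hx]

lemma hypS_tri (a b c : HypE) : (hypTri a b c).indicator 1 ∈ hypS :=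
  Submodule.subset_span (Or.inl ⟨a, b, c, rfl⟩)

open MeasureTheory in
lemma hypS_of_null_diff (A B N : Set HypE) (hN : volume N = 0) (h : ∀ x, x ∉ N → (x ∈ A ↔ x ∈ B))
    (hB : B.indicator 1 ∈ hypS) : A.indicator 1 ∈ hypS := by
  apply hypS_congr _ hB
  have : ∀ᵐ x ∂(volume : Measure HypE), x ∉ N := measure_eq_zero_iff_ae_notMem.1 hN
  filter_upwards [this] with x hx
  have := h x hx
  by_cases hA : x ∈ A
  · rw [Set.indicator_of_mem hA, Set.indicator_of_mem (this.1 hA)]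
  · rw [Set.indicator_of_notMem hA, Set.indicator_of_notMem (fun h => hA (this.2 h))]

/-- one positive vertex -/
lemma hypS_cut_one (a b c : HypE) (l : HypE →ₗ[ℝ] ℝ) (k : ℝ) (ha : 0 < l a + k) (hb : l b + k ≤ 0) (hc : l c + k ≤ 0) :
    ({x | 0 < l x + k} ∩ hypTri a b c).indicator 1 ∈ hypS := by
  obtain ⟨p, q, h⟩ := hypTri_cut a b c l k ha hb hc
  have hl : l ≠ 0 := by rintro rfl; simp at ha hb; linarith
  apply hypS_of_null_diff _ _ _ (hyp_line_null l k hl) _ (hypS_tri a p q)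
  intro x hx
  rw [← h]
  simp only [Set.mem_inter_iff, Set.mem_ofPred_eq] at hx ⊢
  rw [and_comm, lt_iff_le_and_ne]
  simp [Ne.symm hx]

/-- one nonpositive vertex -/
lemma hypS_cut_two (a b c : HypE) (l : HypE →ₗ[ℝ] ℝ) (k : ℝ) (ha : l a + k ≤ 0) (hb : 0 < l b + k) (hc : 0 < l c + k) :
    ({x | 0 < l x + k} ∩ hypTri a b c).indicator 1 ∈ hypS := by
  have hl : l ≠ 0 := by rintro rfl; simp at ha hb; linarith
  rcases eq_or_lt_of_le ha with ha | ha
  · apply hypS_of_null_diff _ _ _ (hyp_line_null l k hl) _ (hypS_tri a b c)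
    intro x hx
    simp only [Set.mem_inter_iff, Set.mem_ofPred_eq] at hx ⊢
    constructor
    · exact fun h => h.2
    · intro h
      refine ⟨?_, h⟩
      obtain ⟨r, u, v, hr, hu, hv, hs, he⟩ := hypTri_apply l k h
      apply lt_of_le_of_ne _ (Ne.symm hx)
      rw [he, ha]
      positivity
  · obtain ⟨p, q, h⟩ := hypTri_cut a b c (-l) (-k) (by simp; linarith) (by simp; linarith) (by simp; linarith)
    have : ({x | 0 < l x + k} ∩ hypTri a b c).indicator (1 : HypE → ℂ) = (hypTri a b c).indicator 1 - (hypTri a p q).indicator 1 := by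
      rw [← h]
      ext x
      by_cases h1 : x ∈ hypTri a b c <;> by_cases h2 : 0 < l x + k
      · have h3 : ¬ (k ≤ -l x) := by intro h; linarith
        simp [Set.indicator, h1, h2, h3]
      · have h3 : k ≤ -l x := by linarith
        simp [Set.indicator, h1, h2, h3]
      · simp [Set.indicator, h1]
      · simp [Set.indicator, h1]
    rw [this]
    exact Submodule.sub_mem _ (hypS_tri _ _ _) (hypS_tri _ _ _)

lemma hypTri_rot (a b c : HypE) : hypTri a b c = hypTri b c a := by
  unfold hypTri; congr 1; ext x; simp only [Set.mem_insert_iff, Set.mem_singleton_iff]; tauto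

lemma hypS_cut (a b c : HypE) (l : HypE →ₗ[ℝ] ℝ) (k : ℝ) :
    ({x | 0 < l x + k} ∩ hypTri a b c).indicator 1 ∈ hypS := by
  have r1 := hypTri_rot a b c
  have r2 := hypTri_rot b c a
  rcases lt_or_ge 0 (l a + k) with ha | ha <;> rcases lt_or_ge 0 (l b + k) with hb | hb <;>
    rcases lt_or_ge 0 (l c + k) with hc | hc
  · have : {x | 0 < l x + k} ∩ hypTri a b c = hypTri a b c := by
      apply Set.inter_eq_right.2
      intro x hx
      obtain ⟨r, u, v, hr, hu, hv, hs, he⟩ := hypTri_apply l k hx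
      show 0 < l x + k
      by_contra hcon
      have h1 := mul_nonneg hr ha.le
      have h2 := mul_nonneg hu hb.le
      have h3 := mul_nonneg hv hc.le
      have h1' : r = 0 := by
        have : r * (l a + k) = 0 := by linarith
        exact (mul_eq_zero.1 this).resolve_right ha.ne'
      have h2' : u = 0 := by
        have : u * (l b + k) = 0 := by linarith
        exact (mul_eq_zero.1 this).resolve_right hb.ne'
      have h3' : v = 0 := by
        have : v * (l c + k) = 0 := by linarith
        exact (mul_eq_zero.1 this).resolve_right hc.ne'
      linarith
    rw [this]; exact hypS_tri _ _ _
  · rw [r1, r2]; exact hypS_cut_two _ _ _ l k hc ha hb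
  · rw [r1]; exact hypS_cut_two _ _ _ l k hb hc ha
  · exact hypS_cut_one _ _ _ l k ha hb hc
  · exact hypS_cut_two _ _ _ l k ha hb hc
  · rw [r1]; exact hypS_cut_one _ _ _ l k hb hc ha
  · rw [r1, r2]; exact hypS_cut_one _ _ _ l k hc ha hb
  · have : {x | 0 < l x + k} ∩ hypTri a b c = ∅ := by
      ext x
      simp only [Set.mem_inter_iff, Set.mem_ofPred_eq, Set.mem_empty_iff_false, iff_false]
      rintro ⟨h, hx⟩
      obtain ⟨r, u, v, hr, hu, hv, hs, he⟩ := hypTri_apply l k hx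
      nlinarith
    rw [this, Set.indicator_empty]; exact Submodule.zero_mem _

open MeasureTheory in
lemma hypS_half (l : HypE →ₗ[ℝ] ℝ) (k : ℝ) (f : HypE → ℂ) (hf : f ∈ hypS) :
    {x | 0 < l x + k}.indicator f ∈ hypS := by
  induction hf using Submodule.span_induction with
  | mem f hf =>
    rcases hf with ⟨a, b, c, rfl⟩ | hf
    · rw [Set.indicator_indicator]; exact hypS_cut a b c l k
    · apply hypS_null
      filter_upwards [hf] with x hx
      simp [Set.indicator, hx]
  | zero => rw [Set.indicator_zero']; exact Submodule.zero_mem _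
  | add f g _ _ hf hg => rw [Set.indicator_add']; exact Submodule.add_mem _ hf hg
  | smul r f _ hf =>
    have : {x | 0 < l x + k}.indicator (r • f) = r • {x | 0 < l x + k}.indicator f := by
      ext x; simp [Set.indicator]
    rw [this]; exact Submodule.smul_mem _ _ hf

lemma hypS_half' (l : HypE →ₗ[ℝ] ℝ) (k : ℝ) (f : HypE → ℂ) (hf : f ∈ hypS) :
    {x | 0 ≤ l x + k}.indicator f ∈ hypS := by
  have : {x | 0 ≤ l x + k}.indicator f = f - {x | 0 < (-l) x + (-k)}.indicator f := by
    ext x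
    by_cases h : 0 ≤ l x + k
    · have h' : ¬ (k < - l x) := by linarith
      simp [Set.indicator, h, h']
    · have h' : k < - l x := by linarith
      simp [Set.indicator, h, h']
  rw [this]
  exact Submodule.sub_mem _ hf (hypS_half _ _ _ hf)

/-- Linear coordinates. -/
lemma hyp_equiv (p q : HypE) (h : LinearIndependent ℝ ![p, q]) :
    ∃ φ : (ℝ × ℝ) ≃L[ℝ] HypE, ∀ y, φ y = y.1 • p + y.2 • q := by
  let L : ℝ × ℝ →ₗ[ℝ] HypE := (LinearMap.toSpanSingleton ℝ HypE p).coprod (LinearMap.toSpanSingleton ℝ HypE q)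
  have hL : ∀ y, L y = y.1 • p + y.2 • q := by intro y; simp [L]
  have hinj : Function.Injective L := by
    rw [← LinearMap.ker_eq_bot, LinearMap.ker_eq_bot']
    intro y hy
    rw [hL] at hy
    have := LinearIndependent.pair_iff.1 h _ _ hy
    exact Prod.ext this.1 this.2
  refine ⟨(LinearEquiv.ofInjectiveOfFinrankEq L hinj (by simp)).toContinuousLinearEquiv, ?_⟩
  intro y
  rw [← hL]; rfl

open MeasureTheory in
lemma hypS_tri_mul (a b c : HypE) (f : HypE → ℂ) (hf : f ∈ hypS) :
    (hypTri a b c).indicator f ∈ hypS := by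
  by_cases h : LinearIndependent ℝ ![b - a, c - a]
  · obtain ⟨φ, hφ⟩ := hyp_equiv _ _ h
    let l1 : HypE →ₗ[ℝ] ℝ := (LinearMap.fst ℝ ℝ ℝ) ∘ₗ φ.symm.toLinearEquiv.toLinearMap
    let l2 : HypE →ₗ[ℝ] ℝ := (LinearMap.snd ℝ ℝ ℝ) ∘ₗ φ.symm.toLinearEquiv.toLinearMap
    have h1 : ∀ x, l1 x = (φ.symm x).1 := fun x => rfl
    have h2 : ∀ x, l2 x = (φ.symm x).2 := fun x => rfl
    have : hypTri a b c = {x | 0 ≤ l1 x + (- l1 a)} ∩ ({x | 0 ≤ l2 x + (-l2 a)} ∩ {x | 0 ≤ (-l1 - l2) x + (1 + l1 a + l2 a)}) := by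
      ext x
      rw [mem_hypTri]
      simp only [Set.mem_inter_iff, Set.mem_ofPred_eq, LinearMap.sub_apply, LinearMap.neg_apply]
      constructor
      · rintro ⟨u, v, hu, hv, huv, rfl⟩
        have e : φ.symm (u • (b - a) + v • (c - a)) = (u, v) := by
          rw [ContinuousLinearEquiv.symm_apply_eq, hφ]
        have e1 : l1 (a + (u • (b - a) + v • (c - a))) = l1 a + u := by rw [map_add, h1 (_ + _), e]
        have e2 : l2 (a + (u • (b - a) + v • (c - a))) = l2 a + v := by rw [map_add, h2 (_ + _), e]
        rw [e1, e2]
        exact ⟨by linarith, by linarith, by linarith⟩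
      · rintro ⟨g1, g2, g3⟩
        refine ⟨l1 x - l1 a, l2 x - l2 a, by linarith, by linarith, by linarith, ?_⟩
        have := hφ (φ.symm (x - a))
        rw [← h1, ← h2, ContinuousLinearEquiv.apply_symm_apply, map_sub, map_sub] at this
        rw [← this]; simp
    rw [this, ← Set.indicator_indicator, ← Set.indicator_indicator]
    exact hypS_half' _ _ _ (hypS_half' _ _ _ (hypS_half' _ _ _ hf))
  · apply hypS_null
    filter_upwards [measure_eq_zero_iff_ae_notMem.1 (hypTri_null a b c h)] with x hx
    simp [hx]

/-- Sets acting on the span. -/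
def HypG (A : Set HypE) : Prop :=
  A.indicator 1 ∈ hypS ∧ ∀ f ∈ hypS, A.indicator f ∈ hypS

lemma HypG.union {A B : Set HypE} (hA : HypG A) (hB : HypG B) : HypG (A ∪ B) := by
  have key : ∀ f : HypE → ℂ, (A ∪ B).indicator f = A.indicator f + B.indicator f - A.indicator (B.indicator f) := by
    intro f; ext x
    by_cases h1 : x ∈ A <;> by_cases h2 : x ∈ B <;> simp [Set.indicator, h1, h2]
  constructor
  · rw [key]
    exact Submodule.sub_mem _ (Submodule.add_mem _ hA.1 hB.1) (hA.2 _ hB.1)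
  · intro f hf
    rw [key]
    exact Submodule.sub_mem _ (Submodule.add_mem _ (hA.2 f hf) (hB.2 f hf)) (hA.2 _ (hB.2 f hf))

lemma HypG.empty : HypG ∅ := by
  constructor
  · rw [Set.indicator_empty]; exact Submodule.zero_mem _
  · intro f _; rw [Set.indicator_empty]; exact Submodule.zero_mem _

lemma HypG.biUnion {ι : Type*} (W : Finset ι) (A : ι → Set HypE) (h : ∀ i ∈ W, HypG (A i)) :
    HypG (⋃ i ∈ W, A i) := by
  classical
  induction W using Finset.induction_on with
  | empty => simpa using HypG.empty
  | insert i W hi ih =>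
    rw [Finset.set_biUnion_insert]
    exact (h i (by simp)).union (ih fun j hj => h j (by simp [hj]))

lemma HypG.hull (V : Finset HypE) : HypG (convexHull ℝ (V : Set HypE)) := by
  have : convexHull ℝ (V : Set HypE) = ⋃ τ ∈ V ×ˢ V ×ˢ V, hypTri τ.1 τ.2.1 τ.2.2 := by
    apply Set.Subset.antisymm
    · intro x hx
      rw [convexHull_eq_union] at hx
      simp only [Set.mem_iUnion] at hx
      obtain ⟨t, hts, hai, hx⟩ := hx
      have hcard : t.card ≤ 3 := by
        have := hai.card_le_finrank_succ
        have h2 := Submodule.finrank_le (vectorSpan ℝ (Set.range ((↑) : t → HypE)))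
        simp at this h2
        omega
      have hne : t.Nonempty := by
        rw [Finset.nonempty_iff_ne_empty]; rintro rfl; simp at hx
      have habc : ∃ a b c, t = {a, b, c} := by
        have hpos := hne.card_pos
        have : t.card = 1 ∨ t.card = 2 ∨ t.card = 3 := by omega
        rcases this with h | h | h
        · obtain ⟨a, rfl⟩ := Finset.card_eq_one.1 h; exact ⟨a, a, a, by simp⟩
        · obtain ⟨a, b, -, rfl⟩ := Finset.card_eq_two.1 h; exact ⟨a, b, b, by simp⟩
        · obtain ⟨a, b, c, -, -, -, rfl⟩ := Finset.card_eq_three.1 h; exact ⟨a, b, c, rfl⟩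
      obtain ⟨a, b, c, rfl⟩ := habc
      simp only [Set.mem_iUnion]
      refine ⟨(a, b, c), ?_, ?_⟩
      · simp only [Finset.mem_product]
        exact ⟨hts (by simp), hts (by simp), hts (by simp)⟩
      · unfold hypTri; simpa using hx
    · simp only [Set.iUnion_subset_iff, Finset.mem_product]
      rintro ⟨a, b, c⟩ ⟨ha, hb, hc⟩
      apply convexHull_mono
      rintro x (rfl | rfl | rfl) <;> assumption
  rw [this]
  apply HypG.biUnion
  intro τ _
  exact ⟨hypS_tri _ _ _, fun f hf => hypS_tri_mul _ _ _ f hf⟩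

/-- The exponential kernel. -/
noncomputable def hypExp (s x : HypE) : ℂ := Complex.exp (-Complex.I * ((inner ℝ s x : ℝ) : ℂ))

lemma hyp_inner (s x : HypE) : inner ℝ s x = s 0 * x 0 + s 1 * x 1 := by
  simp [PiLp.inner_apply, Fin.sum_univ_two, mul_comm]

lemma hypExp_continuous (s : HypE) : Continuous (hypExp s) := by
  unfold hypExp; fun_prop

lemma hypExp_norm (s x : HypE) : ‖hypExp s x‖ = 1 := by
  unfold hypExp
  rw [neg_mul, mul_comm, ← neg_mul, ← Complex.ofReal_neg, Complex.norm_exp_ofReal_mul_I]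

open MeasureTheory in
lemma hypExp_integrable {f : HypE → ℂ} (hf : Integrable f volume) (s : HypE) :
    Integrable (fun x => f x * hypExp s x) volume :=
  hf.mul_bdd (c := 1) (hypExp_continuous s).aestronglyMeasurable
    (Filter.Eventually.of_forall fun x => (hypExp_norm s x).le)

open Polynomial in
/-- Linear form. -/
noncomputable def hypL (w : HypE) : ℂ[X] := C (w 0 : ℂ) * X + C (w 1 : ℂ)

open Polynomial in
lemma hypL_eval (s w : HypE) (hs : s 1 ≠ 0) :
    ((inner ℝ s w : ℝ) : ℂ) = (s 1 : ℂ) * (hypL w).eval ((s 0 / s 1 : ℝ) : ℂ) := by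
  have : (s 1 : ℂ) ≠ 0 := by exact_mod_cast hs
  rw [hyp_inner]
  simp only [hypL, eval_add, eval_mul, eval_C, eval_X]
  push_cast
  field_simp

open Polynomial in
lemma hypL_ne (w : HypE) (hw : w ≠ 0) : hypL w ≠ 0 := by
  intro h
  apply hw
  have h0 := congrArg (fun q => coeff q 0) h
  have h1 := congrArg (fun q => coeff q 1) h
  simp [hypL, coeff_C] at h0 h1
  ext i; fin_cases i
  · simpa using h1
  · simpa using h0

open Polynomial MeasureTheory in
/-- Exponential-rational form of the transform. -/
def HypClass (f : HypE → ℂ) : Prop :=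
  ∃ D : ℂ[X], D ≠ 0 ∧ ∃ n : HypE →₀ ℂ[X], ∀ s : HypE, s 1 ≠ 0 →
    (s 1 : ℂ) ^ 2 * D.eval ((s 0 / s 1 : ℝ) : ℂ) * ∫ x, f x * hypExp s x =
      n.sum fun v p => p.eval ((s 0 / s 1 : ℝ) : ℂ) * hypExp s v

open Polynomial MeasureTheory in
lemma hypClass_tri (a b c : HypE) (h : LinearIndependent ℝ ![b - a, c - a]) :
    HypClass ((hypTri a b c).indicator 1) := by
  obtain ⟨φ, hφ⟩ := hyp_equiv _ _ h
  have hm := Measure.isAddLeftInvariant_eq_smul (volume : Measure HypE) ((volume : Measure (ℝ × ℝ)).map φ)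
  set κ := (volume : Measure HypE).addHaarScalarFactor ((volume : Measure (ℝ × ℝ)).map φ) with hκ
  clear_value κ
  have hpq := LinearIndependent.pair_iff.1 h
  have hp : b - a ≠ 0 := by
    intro h0; have := hpq 1 0 (by simp [h0]); simp at this
  have hq : c - a ≠ 0 := by
    intro h0; have := hpq 0 1 (by simp [h0]); simp at this
  have hpq' : (b - a) - (c - a) ≠ 0 := by
    intro h0; have := hpq 1 (-1) (by rw [← h0]; module); simp at this
  refine ⟨hypL (b - a) * hypL (c - a) * hypL ((b - a) - (c - a)),
    mul_ne_zero (mul_ne_zero (hypL_ne _ hp) (hypL_ne _ hq)) (hypL_ne _ hpq'),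
    Finsupp.single a (C (-(κ : ℂ)) * hypL ((b - a) - (c - a))) + Finsupp.single b (C (-(κ : ℂ)) * hypL (c - a))
     + Finsupp.single c (C (κ : ℂ) * hypL (b - a)), ?_⟩
  intro s hs
  have hsc : (s 1 : ℂ) ≠ 0 := by exact_mod_cast hs
  rw [Finsupp.sum_add_index' (by simp) (by intros; rw [eval_add, add_mul]),
    Finsupp.sum_add_index' (by simp) (by intros; rw [eval_add, add_mul]),
    Finsupp.sum_single_index (by simp), Finsupp.sum_single_index (by simp), Finsupp.sum_single_index (by simp)]
  have hI : ∫ x, (hypTri a b c).indicator 1 x * hypExp s x = (κ : ℂ) * (hypExp s a *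
      ∫ y : ℝ × ℝ, Set.indicator {y : ℝ × ℝ | 0 ≤ y.1 ∧ 0 ≤ y.2 ∧ y.1 + y.2 ≤ 1}
        (fun y => Complex.exp (-Complex.I * ((y.1 * (inner ℝ s (b - a)) + y.2 * (inner ℝ s (c - a)) : ℝ) : ℂ))) y) := by
    rw [← integral_add_left_eq_self _ a]
    conv_lhs => rw [hm]
    rw [integral_smul_nnreal_measure, NNReal.smul_def, Complex.real_smul]
    congr 1
    have hmap := integral_map_equiv (μ := (volume : Measure (ℝ × ℝ))) φ.toHomeomorph.toMeasurableEquiv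
      (fun x => (hypTri a b c).indicator 1 (a + x) * hypExp s (a + x))
    refine hmap.trans ?_
    rw [← integral_const_mul]
    congr 1
    ext y
    have hy : φ.toHomeomorph.toMeasurableEquiv y = y.1 • (b - a) + y.2 • (c - a) := hφ y
    rw [hy]
    have hmem : a + (y.1 • (b - a) + y.2 • (c - a)) ∈ hypTri a b c ↔ y ∈ {y : ℝ × ℝ | 0 ≤ y.1 ∧ 0 ≤ y.2 ∧ y.1 + y.2 ≤ 1} := by
      rw [mem_hypTri]
      constructor
      · rintro ⟨u, v, hu, hv, huv, he⟩
        have : φ y = φ (u, v) := by rw [hφ, hφ]; exact add_left_cancel he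
        rw [φ.injective this]
        exact ⟨hu, hv, huv⟩
      · rintro ⟨h1, h2, h3⟩
        exact ⟨y.1, y.2, h1, h2, h3, rfl⟩
    by_cases hyy : y ∈ {y : ℝ × ℝ | 0 ≤ y.1 ∧ 0 ≤ y.2 ∧ y.1 + y.2 ≤ 1}
    · rw [Set.indicator_of_mem (hmem.2 hyy), Set.indicator_of_mem hyy, Pi.one_apply, one_mul, hypExp, hypExp,
        ← Complex.exp_add, inner_add_right, inner_add_right, real_inner_smul_right, real_inner_smul_right]
      congr 1; push_cast; ring
    · rw [Set.indicator_of_notMem (fun h => hyy (hmem.1 h)), Set.indicator_of_notMem hyy]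
      simp
  have hS := hyp_simplex_integral (inner ℝ s (b - a)) (inner ℝ s (c - a))
  rw [← Complex.ofReal_sub, ← inner_sub_right] at hS
  rw [hI]
  generalize (∫ y : ℝ × ℝ, Set.indicator {y : ℝ × ℝ | 0 ≤ y.1 ∧ 0 ≤ y.2 ∧ y.1 + y.2 ≤ 1}
        (fun y => Complex.exp (-Complex.I * ((y.1 * (inner ℝ s (b - a)) + y.2 * (inner ℝ s (c - a)) : ℝ) : ℂ))) y) = K at hS ⊢
  have eb : hypExp s b = hypExp s a * Complex.exp (-Complex.I * ((inner ℝ s (b - a) : ℝ) : ℂ)) := by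
    unfold hypExp; rw [← Complex.exp_add, inner_sub_right]; congr 1; push_cast; ring
  have ec : hypExp s c = hypExp s a * Complex.exp (-Complex.I * ((inner ℝ s (c - a) : ℝ) : ℂ)) := by
    unfold hypExp; rw [← Complex.exp_add, inner_sub_right]; congr 1; push_cast; ring
  rw [eb, ec]
  generalize Complex.exp (-Complex.I * ((inner ℝ s (b - a) : ℝ) : ℂ)) = Eb at hS ⊢
  generalize Complex.exp (-Complex.I * ((inner ℝ s (c - a) : ℝ) : ℂ)) = Ec at hS ⊢
  rw [hypL_eval s _ hs, hypL_eval s _ hs, hypL_eval s _ hs] at hS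
  simp only [eval_mul, eval_C]
  generalize eval ((s 0 / s 1 : ℝ) : ℂ) (hypL (b - a)) = p at hS ⊢
  generalize eval ((s 0 / s 1 : ℝ) : ℂ) (hypL (c - a)) = q at hS ⊢
  generalize eval ((s 0 / s 1 : ℝ) : ℂ) (hypL ((b - a) - (c - a))) = r at hS ⊢
  have hI3 : Complex.I * (s 1 : ℂ) ≠ 0 := mul_ne_zero Complex.I_ne_zero hsc
  have hS' : (Complex.I * (s 1 : ℂ)) * (-((s 1 : ℂ) ^ 2 * (p * q * r) * K)) = (Complex.I * (s 1 : ℂ)) * (r + q * Eb - p * Ec) := by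
    calc _ = (Complex.I * Complex.I) * Complex.I * ((s 1 : ℂ) ^ 3 * (p * q * r) * K) := by rw [Complex.I_mul_I]; ring
      _ = _ := by linear_combination hS
  have hS'' := mul_left_cancel₀ hI3 hS'
  linear_combination (-(κ : ℂ) * hypExp s a) * hS''

open Polynomial MeasureTheory in
lemma hypS_class (f : HypE → ℂ) (hf : f ∈ hypS) : Integrable f volume ∧ HypClass f := by
  have hnull : ∀ f : HypE → ℂ, f =ᵐ[volume] 0 → Integrable f volume ∧ HypClass f := by
    intro f hf
    refine ⟨(integrable_zero _ _ _).congr hf.symm, 1, one_ne_zero, 0, ?_⟩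
    intro s hs
    have : ∫ x, f x * hypExp s x = 0 := by
      apply integral_eq_zero_of_ae
      filter_upwards [hf] with x hx
      simp [hx]
    rw [this]; simp
  induction hf using Submodule.span_induction with
  | mem f hf =>
    rcases hf with ⟨a, b, c, rfl⟩ | hf
    · by_cases h : LinearIndependent ℝ ![b - a, c - a]
      · refine ⟨?_, hypClass_tri a b c h⟩
        rw [integrable_indicator_iff (hypTri_isCompact a b c).measurableSet]
        exact (continuous_const (y := (1:ℂ))).continuousOn.integrableOn_compact (hypTri_isCompact a b c)
      · apply hnull
        filter_upwards [measure_eq_zero_iff_ae_notMem.1 (hypTri_null a b c h)] with x hx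
        simp [hx]
    · exact hnull f hf
  | zero => exact hnull 0 (by rfl)
  | add f g _ _ hf hg =>
    obtain ⟨hfi, D, hD, n, hn⟩ := hf
    obtain ⟨hgi, D', hD', n', hn'⟩ := hg
    refine ⟨hfi.add hgi, D * D', mul_ne_zero hD hD', n.mapRange (fun p => D' * p) (by simp) + n'.mapRange (fun p => D * p) (by simp), ?_⟩
    intro s hs
    rw [Finsupp.sum_add_index' (by simp) (by intros; rw [eval_add, add_mul]),
      Finsupp.sum_mapRange_index (by simp), Finsupp.sum_mapRange_index (by simp)]
    have e : ∫ x, (f + g) x * hypExp s x = (∫ x, f x * hypExp s x) + ∫ x, g x * hypExp s x := by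
      rw [← integral_add (hypExp_integrable hfi s) (hypExp_integrable hgi s)]
      congr 1; ext x; simp [add_mul]
    have h1 := hn s hs
    have h2 := hn' s hs
    simp only [eval_mul, mul_assoc]
    rw [← Finsupp.mul_sum, ← Finsupp.mul_sum, ← h1, ← h2, e]
    ring
  | smul r f _ hf =>
    obtain ⟨hfi, D, hD, n, hn⟩ := hf
    refine ⟨hfi.smul r, D, hD, n.mapRange (fun p => C r * p) (by simp), ?_⟩
    intro s hs
    rw [Finsupp.sum_mapRange_index (by simp)]
    have e : ∫ x, (r • f) x * hypExp s x = r * (∫ x, f x * hypExp s x) := by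
      rw [← integral_const_mul]
      congr 1; ext x; simp [mul_assoc]
    simp only [eval_mul, mul_assoc, eval_C]
    rw [← Finsupp.mul_sum, e, ← hn s hs]
    ring

lemma hyp_genPoly (P : Set HypE) (hP : IsGenPolytope P) :
    IsCompact P ∧ P ⊆ closure (interior P) ∧ P.indicator 1 ∈ hypS := by
  obtain ⟨m, Q, hQ, rfl⟩ := hP
  refine ⟨?_, ?_, ?_⟩
  · apply isCompact_iUnion
    intro i
    obtain ⟨V, hV, -⟩ := hQ i
    rw [hV]; exact Set.Finite.isCompact_convexHull ℝ V.finite_toSet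
  · apply Set.iUnion_subset
    intro i
    obtain ⟨V, hV, hint⟩ := hQ i
    have hc : Convex ℝ (Q i) := by rw [hV]; exact convex_convexHull _ _
    calc Q i ⊆ closure (Q i) := subset_closure
      _ = closure (interior (Q i)) := (hc.closure_interior_eq_closure_of_nonempty_interior hint).symm
      _ ⊆ _ := closure_mono (interior_mono (Set.subset_iUnion Q i))
  · have := HypG.biUnion Finset.univ Q (by
      intro i _
      obtain ⟨V, hV, -⟩ := hQ i
      rw [hV]; exact HypG.hull V)
    simpa using this.1

open MeasureTheory in
lemma hyp_ft (P : Set HypE) (hP : IsCompact P) (s : HypE) :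
    ∫ x, P.indicator 1 x * hypExp s x = fourierTransformSet P s := by
  unfold fourierTransformSet
  rw [← integral_indicator hP.measurableSet]
  congr 1; ext x
  by_cases h : x ∈ P <;> simp [h, hypExp]

open MeasureTheory in
lemma hyp_subset (P Q : Set HypE) (hP : P ⊆ closure (interior P)) (hQ : IsClosed Q)
    (h : (volume : Measure HypE).restrict P = volume.restrict Q) : P ⊆ Q := by
  have h1 : volume (interior P \ Q) = 0 := by
    have e := congrArg (fun μ => μ (interior P \ Q)) h
    have hm : MeasurableSet (interior P \ Q) := isOpen_interior.measurableSet.diff hQ.measurableSet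
    simp only [Measure.restrict_apply hm] at e
    have e1 : interior P \ Q ∩ P = interior P \ Q :=
      Set.inter_eq_left.2 (fun x hx => interior_subset hx.1)
    have e2 : interior P \ Q ∩ Q = ∅ := by ext x; simp
    rw [e1, e2] at e
    simpa using e
  have h2 : interior P \ Q = ∅ := by
    rw [← IsOpen.measure_eq_zero_iff (μ := (volume : Measure HypE)) (isOpen_interior.sdiff hQ)]
    exact h1
  exact hP.trans (closure_minimal (Set.sdiff_eq_empty.1 h2) hQ)

open Polynomial MeasureTheory in
lemma hyp_dense (D : ℂ[X]) (hD : D ≠ 0) :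
    Dense {s : HypE | s 1 ≠ 0 ∧ D.eval ((s 0 / s 1 : ℝ) : ℂ) ≠ 0} := by
  apply Measure.dense_of_ae (μ := (volume : Measure HypE))
  let l0 : HypE →ₗ[ℝ] ℝ := ((EuclideanSpace.proj 0 : HypE →L[ℝ] ℝ) : HypE →ₗ[ℝ] ℝ)
  let l1 : HypE →ₗ[ℝ] ℝ := ((EuclideanSpace.proj 1 : HypE →L[ℝ] ℝ) : HypE →ₗ[ℝ] ℝ)
  have h0 : ∀ x, l0 x = x 0 := fun x => rfl
  have h1 : ∀ x, l1 x = x 1 := fun x => rfl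
  have a1 : ∀ᵐ s : HypE, s 1 ≠ 0 := by
    have := measure_eq_zero_iff_ae_notMem.1 (hyp_line_null l1 0 (by
      intro h; have := h1 (EuclideanSpace.single 1 1); rw [h] at this; simp at this))
    filter_upwards [this] with s hs hs'
    exact hs (by show l1 s + 0 = 0; rw [h1, hs', add_zero])
  have a2 : ∀ᵐ s : HypE, ∀ ρ ∈ D.roots.toFinset, s 0 - ρ.re * s 1 ≠ 0 := by
    rw [Filter.eventually_all_finset]
    intro ρ _
    have := measure_eq_zero_iff_ae_notMem.1 (hyp_line_null (l0 - ρ.re • l1) 0 (by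
      intro h
      have := congrArg (fun l => l (EuclideanSpace.single 0 1)) h
      simp [h0, h1] at this))
    filter_upwards [this] with s hs hs'
    exact hs (by show (l0 - ρ.re • l1) s + 0 = 0; simp only [LinearMap.sub_apply, LinearMap.smul_apply, h0, h1, smul_eq_mul, hs', add_zero])
  filter_upwards [a1, a2] with s hs hs2
  refine ⟨hs, fun h => ?_⟩
  apply hs2 ((s 0 / s 1 : ℝ) : ℂ)
  · rw [Multiset.mem_toFinset, mem_roots hD]; exact h
  · rw [Complex.ofReal_re]; field_simp; ring

/-- Two generalized `2`-dimensional polytopes whose Fourier transforms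
agree on the hyperbola arc `σ(I)`, `σ(t) = (t, 1/t)`, for a nonempty open interval `I`
avoiding `0`, coincide. -/
theorem fourier_eq_on_hyperbola_arc_implies_eq
    (P₁ P₂ : Set (EuclideanSpace ℝ (Fin 2)))
    (hP₁ : IsGenPolytope P₁) (hP₂ : IsGenPolytope P₂)
    (I : Set ℝ) (a b : ℝ) (hab : a < b) (hI : I = Set.Ioo a b)
    (h0 : (0 : ℝ) ∉ I)
    (σ : ℝ → EuclideanSpace ℝ (Fin 2))
    (hσ : ∀ t : ℝ, σ t = (WithLp.equiv 2 (Fin 2 → ℝ)).symm ![t, 1 / t])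
    (heq : ∀ t ∈ I, fourierTransformSet P₁ (σ t) = fourierTransformSet P₂ (σ t)) :
    P₁ = P₂ := by
  have h0' : (0:ℝ) ∉ Set.Ioo a b := hI ▸ h0
  obtain ⟨c1, i1, s1⟩ := hyp_genPoly P₁ hP₁
  obtain ⟨c2, i2, s2⟩ := hyp_genPoly P₂ hP₂
  obtain ⟨-, D, hD, n, hn⟩ := hypS_class _ (Submodule.sub_mem _ s1 s2)
  have hF : ∀ s, ∫ x, (P₁.indicator 1 - P₂.indicator 1 : HypE → ℂ) x * hypExp s x =
      fourierTransformSet P₁ s - fourierTransformSet P₂ s := by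
    intro s
    rw [← hyp_ft P₁ c1, ← hyp_ft P₂ c2, ← MeasureTheory.integral_sub (hypExp_integrable (hypS_class _ s1).1 s)
      (hypExp_integrable (hypS_class _ s2).1 s)]
    congr 1; ext x; simp [sub_mul]
  have hn0 : ∀ v ∈ n.support, Polynomial.expand ℂ 2 (n v) = 0 := by
    apply hyp_lin_indep a b hab h0' n.support (fun v => Polynomial.expand ℂ 2 (n v))
    intro t ht
    have ht0 : t ≠ 0 := by rintro rfl; exact h0' ht
    have e0 : (σ t) 0 = t := by rw [hσ]; simp
    have e1 : (σ t) 1 = 1 / t := by rw [hσ]; simp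
    have hs := hn (σ t) (by rw [e1]; simpa using ht0)
    rw [hF, heq t (hI ▸ ht), sub_self, mul_zero, Finsupp.sum] at hs
    rw [hs]
    apply Finset.sum_congr rfl
    intro v _
    have e2 : (((σ t) 0 / (σ t) 1 : ℝ) : ℂ) = (t : ℂ) ^ 2 := by
      rw [e0, e1]; push_cast; field_simp
    rw [e2, Polynomial.expand_eval, hypExp, hyp_inner, e0, e1]
    congr 3
    push_cast; ring
  have hn1 : n = 0 := by
    ext1 v
    by_contra hv
    exact hv ((Polynomial.expand_eq_zero two_pos).1 (hn0 v (Finsupp.mem_support_iff.2 hv)))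
  have hzero : ∀ s : HypE, s 1 ≠ 0 → D.eval ((s 0 / s 1 : ℝ) : ℂ) ≠ 0 →
      fourierTransformSet P₁ s = fourierTransformSet P₂ s := by
    intro s hs hd
    have := hn s hs
    rw [hF, hn1, Finsupp.sum_zero_index, mul_eq_zero, mul_eq_zero] at this
    have hsc : (s 1 : ℂ) ≠ 0 := by exact_mod_cast hs
    rcases this with (h | h) | h
    · exact absurd h (pow_ne_zero _ hsc)
    · exact absurd h hd
    · exact sub_eq_zero.1 h
  have hch : ∀ (P : Set HypE) (s : HypE), MeasureTheory.charFun (MeasureTheory.volume.restrict P) s = fourierTransformSet P (-s) := by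
    intro P s
    rw [MeasureTheory.charFun_apply, fourierTransformSet]
    congr 1; ext x
    rw [inner_neg_left, real_inner_comm]; congr 1; push_cast; ring
  have : MeasureTheory.IsFiniteMeasure ((MeasureTheory.volume : MeasureTheory.Measure HypE).restrict P₁) :=
    ⟨by simpa using c1.measure_lt_top⟩
  have : MeasureTheory.IsFiniteMeasure ((MeasureTheory.volume : MeasureTheory.Measure HypE).restrict P₂) :=
    ⟨by simpa using c2.measure_lt_top⟩
  have hmeas : (MeasureTheory.volume : MeasureTheory.Measure HypE).restrict P₁ = MeasureTheory.volume.restrict P₂ := by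
    apply MeasureTheory.Measure.ext_of_charFun
    apply Continuous.ext_on (hyp_dense D hD) (MeasureTheory.continuous_charFun) (MeasureTheory.continuous_charFun)
    rintro s ⟨hs, hd⟩
    rw [hch, hch]
    apply hzero
    · simpa using hs
    · have : (-s) 0 / (-s) 1 = s 0 / s 1 := by simp [neg_div_neg_eq]
      rw [this]; exact hd
  exact Set.Subset.antisymm (hyp_subset _ _ i1 c2.isClosed hmeas) (hyp_subset _ _ i2 c1.isClosed hmeas.symm)
end
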